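/- Suppose the real eigenvalue sequence satisfies 0 < E_1 < E_2 < ⋯ and the two-sided gap condition c_H·|m−n|/max{m,n}^{2γ} ≤ |E_m − E_n| ≤ C_H·|m−n|/max{m,n}^{2γ} for all m,n ≥ 1, for some γ ∈ (0,1/2) and constants 0 < c_H ≤ C_H; set α := 1 − 2γ. Let p > 2 satisfy ⌈p−1⌉ > 1/(2(1−α)) and let T > 0. Then there exists ε > 0 (depending only on p, γ, c_H, C_H, T) with the following property: for every T-periodic, strongly C¹ family V(t) of bounded self-adjoint operators with ‖V‖_{p,γ} ≤ ε and every propagator U(t,s) for H+V(t), the operator U(t,0) maps Q_H into itself for every t, and for every ψ ∈ Q_H there exists C > 0 such that Σ_n E_n‖P_n U(t,0)ψ‖² ≤ C(1 + t^σ) for all t ≥ 0, where σ := 2α/(2⌈p−1⌉(1−α) − 1). -/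

import Mathlib

noncomputable section

open ContinuousLinearMap

variable {𝓗 : Type*} [NormedAddCommGroup 𝓗] [InnerProductSpace ℂ 𝓗] [CompleteSpace 𝓗]

/-- `⟨x⟩ := max {1, |x|}`. -/
def jap (x : ℝ) : ℝ := max 1 |x|

/-- `(Pₙ)_{n≥1}` is a family of mutually orthogonal nonzero orthogonal projections
with `Σₙ Pₙ = I` in the strong sense. -/
def ProjFamily (P : ℕ+ → 𝓗 →L[ℂ] 𝓗) : Prop :=
  (∀ n, IsSelfAdjoint (P n)) ∧ (∀ n, (P n).comp (P n) = P n) ∧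
  (∀ m n, m ≠ n → (P m).comp (P n) = 0) ∧ (∀ n, P n ≠ 0) ∧
  (∀ ψ : 𝓗, HasSum (fun n => P n ψ) ψ)

/-- The quantity `⟨m-n⟩^p · max{m,n}^(2δ) · ‖Pₘ A Pₙ‖`; the norm `‖A‖_{p,δ}` is its
supremum over `m, n ≥ 1`. -/
def wnorm (P : ℕ+ → 𝓗 →L[ℂ] 𝓗) (p δ : ℝ) (A : 𝓗 →L[ℂ] 𝓗) (m n : ℕ+) : ℝ :=
  jap (((m : ℕ) : ℝ) - ((n : ℕ) : ℝ)) ^ p * (((max m n : ℕ+) : ℕ) : ℝ) ^ (2 * δ) *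
    ‖(P m).comp (A.comp (P n))‖

/-- `A` is diagonal with respect to the family `P`. -/
def IsDiag (P : ℕ+ → 𝓗 →L[ℂ] 𝓗) (A : 𝓗 →L[ℂ] 𝓗) : Prop :=
  ∀ m n, m ≠ n → (P m).comp (A.comp (P n)) = 0

/-- `Dom(H) = {ψ : Σₙ Eₙ²‖Pₙψ‖² < ∞}`. -/
def HDom (P : ℕ+ → 𝓗 →L[ℂ] 𝓗) (E : ℕ+ → ℝ) : Set 𝓗 :=
  {ψ | Summable fun n => (E n) ^ 2 * ‖P n ψ‖ ^ 2}

/-- The form domain `Q_H = {ψ : Σₙ Eₙ‖Pₙψ‖² < ∞}`. -/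
def QDom (P : ℕ+ → 𝓗 →L[ℂ] 𝓗) (E : ℕ+ → ℝ) : Set 𝓗 :=
  {ψ | Summable fun n => E n * ‖P n ψ‖ ^ 2}

/-- `h = Hψ`, i.e. `h = Σₙ Eₙ Pₙ ψ`. -/
def IsHSum (P : ℕ+ → 𝓗 →L[ℂ] 𝓗) (E : ℕ+ → ℝ) (ψ h : 𝓗) : Prop :=
  HasSum (fun n => (E n : ℂ) • P n ψ) h

/-- `U` is unitary. -/
def IsUnitaryOp (U : 𝓗 →L[ℂ] 𝓗) : Prop := U * star U = 1 ∧ star U * U = 1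

/-- A family of bounded operators which is `C¹` in the strong sense. -/
def StrongC1 (V : ℝ → 𝓗 →L[ℂ] 𝓗) : Prop := ∀ ψ : 𝓗, ContDiff ℝ 1 fun t => V t ψ

/-- `U(t,s)` is a propagator for `H + V(t)`. -/
def IsPropagator (P : ℕ+ → 𝓗 →L[ℂ] 𝓗) (E : ℕ+ → ℝ) (V : ℝ → 𝓗 →L[ℂ] 𝓗)
    (U : ℝ → ℝ → 𝓗 →L[ℂ] 𝓗) : Prop :=
  (∀ t s, IsUnitaryOp (U t s)) ∧
  (∀ ψ : 𝓗, Continuous fun ts : ℝ × ℝ => U ts.1 ts.2 ψ) ∧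
  (∀ t, U t t = 1) ∧
  (∀ t s r, (U t s).comp (U s r) = U t r) ∧
  (∀ t s, ⇑(U t s) '' HDom P E = HDom P E) ∧
  (∀ s : ℝ, ∀ ψ ∈ HDom P E, ∀ t : ℝ, ∃ d : 𝓗,
    HasDerivAt (fun τ => U τ s ψ) d t ∧
    ∀ h : 𝓗, IsHSum P E (U t s ψ) h → Complex.I • d = h + V t (U t s ψ))

/-- The Riemann zeta function `ζ(s) = Σ_{n≥1} n^{-s}` (for real `s > 1`). -/
def rzeta (s : ℝ) : ℝ := ∑' n : ℕ+, (((n : ℕ) : ℝ) ^ s)⁻¹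

/-- The constant `C_p = 2^(p+1) (1 + 2 ζ(p-1))`. -/
def Cconst (p : ℝ) : ℝ := 2 ^ (p + 1) * (1 + 2 * rzeta (p - 1))

noncomputable section
open ContinuousLinearMap

def jp (m n : ℕ+) : ℝ := jap (((m : ℕ) : ℝ) - ((n : ℕ) : ℝ))
def mx (m n : ℕ+) : ℝ := (((max m n : ℕ+) : ℕ) : ℝ)
def wt (s d : ℝ) (m n : ℕ+) : ℝ := jp m n ^ (-s) * mx m n ^ (-d)

lemma one_le_jp (m n : ℕ+) : 1 ≤ jp m n := le_max_left _ _
lemma jp_pos (m n : ℕ+) : 0 < jp m n := lt_of_lt_of_le one_pos (one_le_jp m n)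
lemma jp_comm (m n : ℕ+) : jp m n = jp n m := by
  unfold jp jap; rw [abs_sub_comm]
lemma abs_le_jp (m n : ℕ+) : |((m : ℕ) : ℝ) - ((n : ℕ) : ℝ)| ≤ jp m n := le_max_right _ _
lemma jp_tri (m l n : ℕ+) : jp m n ≤ jp m l + jp l n := by
  have h1 := abs_le_jp m l
  have h2 := abs_le_jp l n
  have h3 := one_le_jp m l
  have h4 := one_le_jp l n
  have : jp m n = max 1 |((m : ℕ) : ℝ) - ((n : ℕ) : ℝ)| := rfl
  rw [this]
  refine max_le (by linarith) ?_
  have := abs_sub_le ((m : ℕ) : ℝ) ((l : ℕ) : ℝ) ((n : ℕ) : ℝ)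
  linarith
lemma one_le_pn (n : ℕ+) : (1 : ℝ) ≤ ((n : ℕ) : ℝ) := by exact_mod_cast n.pos
lemma pn_pos (n : ℕ+) : (0 : ℝ) < ((n : ℕ) : ℝ) := by exact_mod_cast n.pos
lemma mx_eq (m n : ℕ+) : mx m n = max ((m : ℕ) : ℝ) ((n : ℕ) : ℝ) := by
  unfold mx
  rcases le_total m n with h | h
  · rw [max_eq_right h, max_eq_right]; exact_mod_cast h
  · rw [max_eq_left h, max_eq_left]; exact_mod_cast h
lemma one_le_mx (m n : ℕ+) : 1 ≤ mx m n := one_le_pn _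
lemma mx_pos (m n : ℕ+) : 0 < mx m n := pn_pos _
lemma mx_comm (m n : ℕ+) : mx m n = mx n m := by unfold mx; rw [max_comm]
lemma wt_comm (s d : ℝ) (m n : ℕ+) : wt s d m n = wt s d n m := by
  unfold wt; rw [jp_comm, mx_comm]
lemma wt_pos (s d : ℝ) (m n : ℕ+) : 0 < wt s d m n :=
  mul_pos (Real.rpow_pos_of_pos (jp_pos _ _) _) (Real.rpow_pos_of_pos (mx_pos _ _) _)
lemma wt_nonneg (s d : ℝ) (m n : ℕ+) : 0 ≤ wt s d m n := (wt_pos s d m n).le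

lemma pn_le (m n : ℕ+) : ((m : ℕ) : ℝ) ≤ 2 * ((n : ℕ) : ℝ) * jp m n := by
  have h1 := abs_le_jp m n
  have h2 := one_le_jp m n
  have h3 := one_le_pn n
  have := le_abs_self (((m : ℕ) : ℝ) - ((n : ℕ) : ℝ))
  nlinarith

lemma mx_le (m l n : ℕ+) : mx m n ≤ 2 * jp m l * mx l n := by
  have h1 := pn_le m l
  have h2 := one_le_jp m l
  have h3 := one_le_pn n
  have h4 : ((l : ℕ) : ℝ) ≤ mx l n := by rw [mx_eq]; exact le_max_left _ _
  have h5 : ((n : ℕ) : ℝ) ≤ mx l n := by rw [mx_eq]; exact le_max_right _ _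
  rw [mx_eq]
  refine max_le ?_ ?_
  · nlinarith
  · nlinarith

lemma jp_summable {ρ : ℝ} (hρ : 1 < ρ) : Summable fun k : ℤ => (max 1 |(k : ℝ)|) ^ (-ρ) := by
  have h := Real.summable_abs_int_rpow hρ
  refine (h.add (summable_of_ne_finset_zero (s := {0})
    (f := fun k : ℤ => if k = 0 then (1 : ℝ) else 0) ?_)).of_nonneg_of_le
    (fun k => by positivity) (fun k => ?_)
  · intro b hb; simp at hb; simp [hb]
  · by_cases hk : k = 0
    · subst hk; simp; positivity
    · have : (1 : ℝ) ≤ |(k : ℝ)| := by exact_mod_cast Int.one_le_abs hk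
      rw [max_eq_right this]; simp [hk]

lemma jp_sum {ρ : ℝ} (hρ : 1 < ρ) : ∃ K > 0, ∀ (F : Finset ℕ+) (m : ℕ+),
    ∑ l ∈ F, jp m l ^ (-ρ) ≤ K := by
  have h := jp_summable hρ
  refine ⟨(∑' k : ℤ, (max 1 |(k : ℝ)|) ^ (-ρ)) + 1, ?_, fun F m => ?_⟩
  · have : 0 ≤ ∑' k : ℤ, (max 1 |(k : ℝ)|) ^ (-ρ) := tsum_nonneg fun k => by positivity
    linarith
  · have hinj : Function.Injective (fun l : ℕ+ => ((m : ℕ) : ℤ) - ((l : ℕ) : ℤ)) := by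
      intro a b hab
      simp at hab
      exact hab
    have : ∑ l ∈ F, jp m l ^ (-ρ) =
        ∑ k ∈ F.map ⟨_, hinj⟩, (max 1 |(k : ℝ)|) ^ (-ρ) := by
      rw [Finset.sum_map]
      refine Finset.sum_congr rfl fun l _ => ?_
      simp [jp, jap]
    rw [this]
    have := h.sum_le_tsum (F.map ⟨_, hinj⟩) (fun k _ => by positivity)
    linarith

lemma jp_conv {ρ : ℝ} (hρ : 1 < ρ) : ∃ K > 0, ∀ (F : Finset ℕ+) (m n : ℕ+),
    ∑ l ∈ F, jp m l ^ (-ρ) * jp l n ^ (-ρ) ≤ K * jp m n ^ (-ρ) := by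
  obtain ⟨K, hK, h⟩ := jp_sum hρ
  refine ⟨2 ^ ρ * (2 * K), by positivity, fun F m n => ?_⟩
  have key : ∀ l, jp m l ^ (-ρ) * jp l n ^ (-ρ) ≤
      2 ^ ρ * jp m n ^ (-ρ) * (jp m l ^ (-ρ) + jp n l ^ (-ρ)) := by
    intro l
    have a0 := jp_pos m l
    have b0 := jp_pos l n
    have c0 := jp_pos m n
    have t := jp_tri m l n
    have A : 0 < jp m l ^ (-ρ) := Real.rpow_pos_of_pos a0 _
    have B : 0 < jp l n ^ (-ρ) := Real.rpow_pos_of_pos b0 _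
    have e : 2 ^ ρ * jp m n ^ (-ρ) = (jp m n / 2) ^ (-ρ) := by
      rw [Real.div_rpow c0.le (by norm_num), Real.rpow_neg (by norm_num : (0:ℝ) ≤ 2)]
      field_simp
    rw [e, jp_comm n l]
    have c2 : 0 < jp m n / 2 := by positivity
    have D : 0 < (jp m n / 2) ^ (-ρ) := Real.rpow_pos_of_pos c2 _
    rcases le_total (jp m l) (jp l n) with hh | hh
    · have : jp l n ^ (-ρ) ≤ (jp m n / 2) ^ (-ρ) :=
        Real.rpow_le_rpow_of_nonpos c2 (by linarith) (by linarith)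
      nlinarith [mul_pos A D, mul_pos B D]
    · have : jp m l ^ (-ρ) ≤ (jp m n / 2) ^ (-ρ) :=
        Real.rpow_le_rpow_of_nonpos c2 (by linarith) (by linarith)
      nlinarith [mul_pos A D, mul_pos B D]
  calc ∑ l ∈ F, jp m l ^ (-ρ) * jp l n ^ (-ρ)
      ≤ ∑ l ∈ F, 2 ^ ρ * jp m n ^ (-ρ) * (jp m l ^ (-ρ) + jp n l ^ (-ρ)) :=
        Finset.sum_le_sum fun l _ => key l
    _ = 2 ^ ρ * jp m n ^ (-ρ) * (∑ l ∈ F, jp m l ^ (-ρ) + ∑ l ∈ F, jp n l ^ (-ρ)) := by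
        rw [← Finset.mul_sum, Finset.sum_add_distrib]
    _ ≤ 2 ^ ρ * jp m n ^ (-ρ) * (K + K) := by
        have : 0 < jp m n ^ (-ρ) := Real.rpow_pos_of_pos (jp_pos _ _) _
        gcongr <;> apply h
    _ = _ := by ring

lemma wt_term {ρ s1 s2 d1 d2 d : ℝ} (hs2 : ρ ≤ s2) (hd1 : 0 ≤ d1) (hd1d : d1 ≤ d)
    (hdd : d ≤ d1 + d2) (hs1d : ρ ≤ s1 - (d - d1)) (m l n : ℕ+) (hmn : n ≤ m) :
    wt s1 d1 m l * wt s2 d2 l n ≤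
      2 ^ d * (mx m n ^ (-d) * (jp m l ^ (-ρ) * jp l n ^ (-ρ))) := by
  have a0 := jp_pos m l
  have b0 := jp_pos l n
  have x0 := mx_pos m n
  have y0 := mx_pos m l
  have z0 := mx_pos l n
  have h1 : mx m l ^ (-d1) ≤ mx m n ^ (-d1) := by
    refine Real.rpow_le_rpow_of_nonpos x0 ?_ (by linarith)
    rw [mx_eq, mx_eq]
    have : ((n : ℕ) : ℝ) ≤ ((m : ℕ) : ℝ) := by exact_mod_cast hmn
    rw [max_eq_left this]; exact le_max_left _ _
  have h2 : mx l n ^ (-d2) ≤ 2 ^ d * (jp m l ^ (d - d1) * mx m n ^ (-(d - d1))) := by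
    calc mx l n ^ (-d2) ≤ mx l n ^ (-(d - d1)) :=
          Real.rpow_le_rpow_of_exponent_le (one_le_mx _ _) (by linarith)
      _ ≤ (mx m n / (2 * jp m l)) ^ (-(d - d1)) := by
          refine Real.rpow_le_rpow_of_nonpos (by positivity) ?_ (by linarith)
          rw [div_le_iff₀ (by positivity)]
          have := mx_le m l n
          linarith
      _ = 2 ^ (d - d1) * (jp m l ^ (d - d1) * mx m n ^ (-(d - d1))) := by
          rw [Real.div_rpow x0.le (by positivity), Real.mul_rpow (by norm_num) a0.le,
            Real.rpow_neg (by norm_num : (0:ℝ) ≤ 2), Real.rpow_neg a0.le]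
          field_simp
      _ ≤ _ := by
          gcongr
          · norm_num
          · linarith
  have h3 : jp m l ^ (-s1) * jp m l ^ (d - d1) ≤ jp m l ^ (-ρ) := by
    rw [← Real.rpow_add a0]
    exact Real.rpow_le_rpow_of_exponent_le (one_le_jp _ _) (by linarith)
  have h4 : jp l n ^ (-s2) ≤ jp l n ^ (-ρ) :=
    Real.rpow_le_rpow_of_exponent_le (one_le_jp _ _) (by linarith)
  have h5 : mx m n ^ (-d1) * mx m n ^ (-(d - d1)) = mx m n ^ (-d) := by
    rw [← Real.rpow_add x0]; congr 1; ring
  have p1 : 0 < jp m l ^ (-s1) := Real.rpow_pos_of_pos a0 _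
  have p2 : 0 < jp l n ^ (-s2) := Real.rpow_pos_of_pos b0 _
  have p3 : 0 < mx l n ^ (-d2) := Real.rpow_pos_of_pos z0 _
  have p4 : 0 < mx m n ^ (-d1) := Real.rpow_pos_of_pos x0 _
  have p5 : 0 < mx m n ^ (-d) := Real.rpow_pos_of_pos x0 _
  have p6 : 0 < jp m l ^ (-ρ) := Real.rpow_pos_of_pos a0 _
  unfold wt
  calc jp m l ^ (-s1) * mx m l ^ (-d1) * (jp l n ^ (-s2) * mx l n ^ (-d2))
      ≤ jp m l ^ (-s1) * mx m n ^ (-d1) * (jp l n ^ (-s2) *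
          (2 ^ d * (jp m l ^ (d - d1) * mx m n ^ (-(d - d1))))) := by gcongr
    _ = 2 ^ d * ((mx m n ^ (-d1) * mx m n ^ (-(d - d1))) *
          ((jp m l ^ (-s1) * jp m l ^ (d - d1)) * jp l n ^ (-s2))) := by ring
    _ ≤ _ := by rw [h5]; gcongr

lemma wt_mul {ρ s1 s2 d1 d2 d : ℝ} (hρ : 1 < ρ) (hs1 : ρ ≤ s1) (hs2 : ρ ≤ s2)
    (hd1 : 0 ≤ d1) (hd2 : 0 ≤ d2) (hd1d : d1 ≤ d) (hd2d : d2 ≤ d)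
    (hdd : d ≤ d1 + d2) (hs1d : ρ ≤ s1 - (d - d1)) (hs2d : ρ ≤ s2 - (d - d2)) :
    ∃ K > 0, ∀ (F : Finset ℕ+) (m n : ℕ+),
      ∑ l ∈ F, wt s1 d1 m l * wt s2 d2 l n ≤ K * wt ρ d m n := by
  obtain ⟨K, hK, h⟩ := jp_conv hρ
  refine ⟨2 ^ d * K, by positivity, fun F m n => ?_⟩
  have key : ∀ l, wt s1 d1 m l * wt s2 d2 l n ≤
      2 ^ d * (mx m n ^ (-d) * (jp m l ^ (-ρ) * jp l n ^ (-ρ))) := by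
    intro l
    rcases le_total n m with hmn | hmn
    · exact wt_term hs2 hd1 hd1d hdd hs1d m l n hmn
    · have := wt_term (d2 := d1) hs1 hd2 hd2d (by linarith) hs2d n l m hmn
      rw [wt_comm s1, wt_comm s2, mul_comm, jp_comm m l, jp_comm l n, mx_comm m n,
        mul_comm (jp l m ^ (-ρ))]
      exact this
  calc _ ≤ ∑ l ∈ F, 2 ^ d * (mx m n ^ (-d) * (jp m l ^ (-ρ) * jp l n ^ (-ρ))) :=
        Finset.sum_le_sum fun l _ => key l
    _ = 2 ^ d * (mx m n ^ (-d) * ∑ l ∈ F, (jp m l ^ (-ρ) * jp l n ^ (-ρ))) := by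
        rw [Finset.mul_sum, Finset.mul_sum]
    _ ≤ 2 ^ d * (mx m n ^ (-d) * (K * jp m n ^ (-ρ))) := by
        have : 0 < mx m n ^ (-d) := Real.rpow_pos_of_pos (mx_pos _ _) _
        gcongr; exact h F m n
    _ = _ := by unfold wt; ring
end

noncomputable section
open ContinuousLinearMap
set_option linter.unusedSectionVars false

variable {𝓗 : Type*} [NormedAddCommGroup 𝓗] [InnerProductSpace ℂ 𝓗] [CompleteSpace 𝓗]

def Dg (P : ℕ+ → 𝓗 →L[ℂ] 𝓗) (F : Finset ℕ+) (f : ℕ+ → ℝ) : 𝓗 →L[ℂ] 𝓗 :=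
  ∑ n ∈ F, (f n : ℂ) • P n

def PF (P : ℕ+ → 𝓗 →L[ℂ] 𝓗) (F : Finset ℕ+) : 𝓗 →L[ℂ] 𝓗 := Dg P F (fun _ => 1)

section basic
variable {P : ℕ+ → 𝓗 →L[ℂ] 𝓗}

lemma PP (hP : ProjFamily P) (n : ℕ+) : P n * P n = P n := hP.2.1 n
lemma PPne (hP : ProjFamily P) {m n : ℕ+} (h : m ≠ n) : P m * P n = 0 := hP.2.2.1 m n h
lemma Psa (hP : ProjFamily P) (n : ℕ+) : star (P n) = P n := hP.1 n

lemma P_norm_le (hP : ProjFamily P) (n : ℕ+) : ‖P n‖ ≤ 1 := by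
  have h : ‖star (P n) * P n‖ = ‖P n‖ * ‖P n‖ := CStarRing.norm_star_mul_self
  rw [Psa hP, PP hP] at h
  by_contra hc
  push Not at hc
  nlinarith

lemma P_mul_Dg_mem (hP : ProjFamily P) (F : Finset ℕ+) {m : ℕ+} (hm : m ∈ F) (f : ℕ+ → ℝ) : P m * Dg P F f = (f m : ℂ) • P m := by
  unfold Dg
  rw [Finset.mul_sum, Finset.sum_eq_single m]
  · rw [mul_smul_comm, PP hP]
  · intro b _ hb; rw [mul_smul_comm, PPne hP hb.symm, smul_zero]
  · intro h; exact absurd hm h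

lemma P_mul_Dg_nmem (hP : ProjFamily P) (F : Finset ℕ+) {m : ℕ+} (hm : m ∉ F) (f : ℕ+ → ℝ) : P m * Dg P F f = 0 := by
  unfold Dg
  rw [Finset.mul_sum]
  refine Finset.sum_eq_zero fun b hb => ?_
  have : m ≠ b := fun h => hm (h ▸ hb)
  rw [mul_smul_comm, PPne hP this, smul_zero]

lemma Dg_star (hP : ProjFamily P) (F : Finset ℕ+) (f : ℕ+ → ℝ) : star (Dg P F f) = Dg P F f := by
  unfold Dg
  rw [star_sum]
  refine Finset.sum_congr rfl fun n _ => ?_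
  rw [star_smul, Psa hP]; simp

lemma Dg_mul_P_mem (hP : ProjFamily P) (F : Finset ℕ+) {m : ℕ+} (hm : m ∈ F) (f : ℕ+ → ℝ) : Dg P F f * P m = (f m : ℂ) • P m := by
  have := congrArg star (P_mul_Dg_mem hP F hm f)
  rw [star_mul, Dg_star hP, star_smul, Psa hP] at this
  simpa using this

lemma Dg_mul_P_nmem (hP : ProjFamily P) (F : Finset ℕ+) {m : ℕ+} (hm : m ∉ F) (f : ℕ+ → ℝ) : Dg P F f * P m = 0 := by
  have := congrArg star (P_mul_Dg_nmem hP F hm f)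
  rw [star_mul, Dg_star hP, Psa hP] at this
  simpa using this

lemma Dg_mul_Dg (hP : ProjFamily P) (F : Finset ℕ+) (f g : ℕ+ → ℝ) : Dg P F f * Dg P F g = Dg P F (fun n => f n * g n) := by
  conv_lhs => rw [Dg]
  rw [Finset.sum_mul]
  unfold Dg
  refine Finset.sum_congr rfl fun n hn => ?_
  have := P_mul_Dg_mem hP F hn g
  unfold Dg at this
  rw [smul_mul_assoc, this, smul_smul]; push_cast; rfl

lemma PF_mul_Dg (hP : ProjFamily P) (F : Finset ℕ+) (f : ℕ+ → ℝ) : PF P F * Dg P F f = Dg P F f := by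
  unfold PF; rw [Dg_mul_Dg hP]; simp
lemma Dg_mul_PF (hP : ProjFamily P) (F : Finset ℕ+) (f : ℕ+ → ℝ) : Dg P F f * PF P F = Dg P F f := by
  unfold PF; rw [Dg_mul_Dg hP]; simp

lemma inner_P (hP : ProjFamily P) (n : ℕ+) (x : 𝓗) : inner ℂ (P n x) x = ((‖P n x‖ ^ 2 : ℝ) : ℂ) := by
  have h1 : P n x = (P n * P n) x := by rw [PP hP]
  have h2 : inner ℂ (P n (P n x)) x = inner ℂ (P n x) (P n x) := by
    have := ContinuousLinearMap.adjoint_inner_left (P n) x (P n x)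
    rw [← ContinuousLinearMap.star_eq_adjoint, Psa hP] at this
    exact this
  rw [h1]
  change inner ℂ (P n (P n x)) x = ((‖P n (P n x)‖ ^ 2 : ℝ) : ℂ)
  rw [h2, show P n (P n x) = P n x from h1.symm, inner_self_eq_norm_sq_to_K]
  simp

lemma inner_Dg (hP : ProjFamily P) (F : Finset ℕ+) (f : ℕ+ → ℝ) (x : 𝓗) :
    inner ℂ (Dg P F f x) x = ((∑ n ∈ F, f n * ‖P n x‖ ^ 2 : ℝ) : ℂ) := by
  unfold Dg
  rw [sum_apply, sum_inner]
  push_cast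
  refine Finset.sum_congr rfl fun n _ => ?_
  change inner ℂ ((f n : ℂ) • (P n x)) x = _
  rw [inner_smul_left, inner_P hP]
  simp

lemma norm_Dg_sq (hP : ProjFamily P) (F : Finset ℕ+) (f : ℕ+ → ℝ) (x : 𝓗) :
    ‖Dg P F f x‖ ^ 2 = ∑ n ∈ F, (f n) ^ 2 * ‖P n x‖ ^ 2 := by
  have h1 : inner ℂ (Dg P F f x) (Dg P F f x) = inner ℂ (Dg P F (fun n => f n * f n) x) x := by
    rw [← Dg_mul_Dg hP]
    have := ContinuousLinearMap.adjoint_inner_left (Dg P F f) x (Dg P F f x)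
    rw [← ContinuousLinearMap.star_eq_adjoint, Dg_star hP] at this
    exact this.symm
  rw [inner_Dg hP, inner_self_eq_norm_sq_to_K] at h1
  have h2 : ‖Dg P F f x‖ ^ 2 = ∑ n ∈ F, f n * f n * ‖P n x‖ ^ 2 :=
    Complex.ofReal_injective (by rw [← h1]; simp)
  rw [h2]
  refine Finset.sum_congr rfl fun n _ => by ring

lemma norm_PF_sq (hP : ProjFamily P) (F : Finset ℕ+) (x : 𝓗) : ‖PF P F x‖ ^ 2 = ∑ n ∈ F, ‖P n x‖ ^ 2 := by
  unfold PF; rw [norm_Dg_sq hP]; simp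

lemma norm_PF_le (hP : ProjFamily P) (F : Finset ℕ+) : ‖PF P F‖ ≤ 1 := by
  have h : ‖star (PF P F) * PF P F‖ = ‖PF P F‖ * ‖PF P F‖ := CStarRing.norm_star_mul_self
  have h2 : star (PF P F) = PF P F := Dg_star hP F _
  have h3 : PF P F * PF P F = PF P F := PF_mul_Dg hP F _
  rw [h2, h3] at h
  by_contra hc
  push Not at hc
  nlinarith

lemma sum_P_sq_le (hP : ProjFamily P) (F : Finset ℕ+) (x : 𝓗) : ∑ n ∈ F, ‖P n x‖ ^ 2 ≤ ‖x‖ ^ 2 := by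
  rw [← norm_PF_sq hP]
  have := (PF P F).le_of_opNorm_le (norm_PF_le hP F) x
  rw [one_mul] at this
  gcongr

lemma norm_Dg_le (hP : ProjFamily P) (F : Finset ℕ+) {f : ℕ+ → ℝ} {C : ℝ} (hC : 0 ≤ C) (hf : ∀ n, |f n| ≤ C) (x : 𝓗) :
    ‖Dg P F f x‖ ≤ C * ‖x‖ := by
  refine abs_le_of_sq_le_sq' ?_ (by positivity) |>.2
  rw [norm_Dg_sq hP, mul_pow]
  calc _ ≤ ∑ n ∈ F, C ^ 2 * ‖P n x‖ ^ 2 := by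
        refine Finset.sum_le_sum fun n _ => ?_
        have := sq_le_sq' (abs_le.1 (hf n)).1 (abs_le.1 (hf n)).2
        gcongr
    _ = C ^ 2 * ∑ n ∈ F, ‖P n x‖ ^ 2 := by rw [Finset.mul_sum]
    _ ≤ _ := by gcongr; exact sum_P_sq_le hP F x

end basic

structure Bd (P : ℕ+ → 𝓗 →L[ℂ] 𝓗) (F : Finset ℕ+) (k : ℕ+ → ℕ+ → ℝ) (A : 𝓗 →L[ℂ] 𝓗) :
    Prop where
  left : PF P F * A = A
  right : A * PF P F = A
  bd : ∀ m n, ‖P m * A * P n‖ ≤ k m n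

section bd
variable {P : ℕ+ → 𝓗 →L[ℂ] 𝓗} {F : Finset ℕ+} {k k1 k2 : ℕ+ → ℕ+ → ℝ} {A B : 𝓗 →L[ℂ] 𝓗}

lemma Bd.mono (h : Bd P F k1 A) (hk : ∀ m n, k1 m n ≤ k m n) : Bd P F k A :=
  ⟨h.left, h.right, fun m n => (h.bd m n).trans (hk m n)⟩

lemma Bd.zero (hk : ∀ m n, 0 ≤ k m n) : Bd P F k 0 :=
  ⟨by simp, by simp, fun m n => by simpa using hk m n⟩

lemma Bd.add (h1 : Bd P F k1 A) (h2 : Bd P F k2 B) :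
    Bd P F (fun m n => k1 m n + k2 m n) (A + B) :=
  ⟨by rw [mul_add, h1.left, h2.left], by rw [add_mul, h1.right, h2.right], fun m n => by
    rw [mul_add, add_mul]
    exact (norm_add_le _ _).trans (add_le_add (h1.bd m n) (h2.bd m n))⟩

lemma Bd.smul (c : ℂ) (h1 : Bd P F k1 A) : Bd P F (fun m n => ‖c‖ * k1 m n) (c • A) :=
  ⟨by rw [mul_smul_comm, h1.left], by rw [smul_mul_assoc, h1.right], fun m n => by
    rw [mul_smul_comm, smul_mul_assoc, norm_smul]
    have := h1.bd m n
    gcongr⟩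

lemma Bd.neg (h1 : Bd P F k A) : Bd P F k (-A) := by
  have := h1.smul (-1)
  simpa using this

lemma Bd.sub (h1 : Bd P F k1 A) (h2 : Bd P F k2 B) :
    Bd P F (fun m n => k1 m n + k2 m n) (A - B) := by
  rw [sub_eq_add_neg]; exact h1.add h2.neg

lemma Bd.star (hP : ProjFamily P) (hk : ∀ m n, k m n = k n m) (h1 : Bd P F k A) :
    Bd P F k (star A) := by
  have hs : Star.star (PF P F) = PF P F := Dg_star hP F _
  refine ⟨?_, ?_, fun m n => ?_⟩
  · have := congrArg Star.star h1.right
    rwa [star_mul, hs] at this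
  · have := congrArg Star.star h1.left
    rwa [star_mul, hs] at this
  · have : P m * Star.star A * P n = Star.star (P n * A * P m) := by
      rw [star_mul, star_mul, Psa hP, Psa hP, mul_assoc]
    rw [this, norm_star, hk]
    exact h1.bd n m

lemma Bd.mul (hP : ProjFamily P) (h1 : Bd P F k1 A) (h2 : Bd P F k2 B)
    (hk : ∀ m n, ∑ l ∈ F, k1 m l * k2 l n ≤ k m n) : Bd P F k (A * B) := by
  refine ⟨by rw [← mul_assoc, h1.left], by rw [mul_assoc, h2.right], fun m n => ?_⟩
  have e : P m * (A * B) * P n = ∑ l ∈ F, (P m * A * P l) * (P l * B * P n) := by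
    have h3 : A * B = ∑ l ∈ F, (A * P l) * (P l * B) := by
      conv_lhs => rw [← h1.right]
      unfold PF Dg
      rw [Finset.mul_sum, Finset.sum_mul]
      refine Finset.sum_congr rfl fun l _ => ?_
      rw [Complex.ofReal_one, one_smul, ← mul_assoc (A * P l), mul_assoc A (P l) (P l), PP hP]
    rw [h3, Finset.mul_sum, Finset.sum_mul]
    refine Finset.sum_congr rfl fun l _ => ?_
    simp only [mul_assoc]
  rw [e]
  refine (norm_sum_le _ _).trans (le_trans (Finset.sum_le_sum fun l _ => ?_) (hk m n))
  refine (norm_mul_le _ _).trans (mul_le_mul (h1.bd m l) (h2.bd l n) (norm_nonneg _) ?_)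
  exact (norm_nonneg _).trans (h1.bd m l)

lemma Bd.P_mul_Dg (hP : ProjFamily P) (h : Bd P F k A) (f : ℕ+ → ℝ) (m : ℕ+) :
    P m * (Dg P F f * A) = (f m : ℂ) • (P m * A) := by
  by_cases hm : m ∈ F
  · rw [← mul_assoc, P_mul_Dg_mem hP F hm, smul_mul_assoc]
  · have h0 : P m * A = 0 := by
      rw [← h.left, ← mul_assoc, PF, P_mul_Dg_nmem hP F hm, zero_mul]
    rw [← mul_assoc, P_mul_Dg_nmem hP F hm, h0]; simp

lemma Bd.Dg_mul_P (hP : ProjFamily P) (h : Bd P F k A) (f : ℕ+ → ℝ) (m : ℕ+) :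
    A * Dg P F f * P m = (f m : ℂ) • (A * P m) := by
  by_cases hm : m ∈ F
  · rw [mul_assoc, Dg_mul_P_mem hP F hm, mul_smul_comm]
  · have h0 : A * P m = 0 := by
      rw [← h.right, mul_assoc, PF, Dg_mul_P_nmem hP F hm, mul_zero]
    rw [mul_assoc, Dg_mul_P_nmem hP F hm, h0]; simp

lemma Bd.comm (hP : ProjFamily P) (h : Bd P F k1 A) (E : ℕ+ → ℝ)
    (hk : ∀ m n, |E m - E n| * k1 m n ≤ k m n) :
    Bd P F k (A * Dg P F E - Dg P F E * A) := by
  refine ⟨?_, ?_, fun m n => ?_⟩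
  · rw [mul_sub, ← mul_assoc, h.left, ← mul_assoc, PF_mul_Dg hP]
  · rw [sub_mul, mul_assoc, Dg_mul_PF hP, mul_assoc, h.right]
  · have e : P m * (A * Dg P F E - Dg P F E * A) * P n = ((E n : ℂ) - E m) • (P m * A * P n) := by
      rw [mul_sub, sub_mul, h.P_mul_Dg hP, mul_assoc (P m) (A * Dg P F E), h.Dg_mul_P hP, sub_smul]
      simp [mul_assoc]
    rw [e, norm_smul]
    refine le_trans ?_ (hk m n)
    have : ‖(E n : ℂ) - E m‖ = |E m - E n| := by
      rw [← Complex.ofReal_sub, Complex.norm_real, Real.norm_eq_abs, abs_sub_comm]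
    rw [this]
    gcongr
    exact h.bd m n

lemma Bd.diag (hP : ProjFamily P) (h : Bd P F k1 A) (f g : ℕ+ → ℝ) :
    Bd P F (fun m n => |f m| * k1 m n * |g n|) (Dg P F f * A * Dg P F g) := by
  refine ⟨?_, ?_, fun m n => ?_⟩
  · rw [← mul_assoc, ← mul_assoc, PF_mul_Dg hP]
  · rw [mul_assoc, Dg_mul_PF hP]
  · have e : P m * (Dg P F f * A * Dg P F g) * P n = ((f m : ℂ) * g n) • (P m * A * P n) := by
      have h1 : P m * (Dg P F f * A * Dg P F g) * P n
          = (P m * (Dg P F f * A)) * (Dg P F g * P n) := by simp only [mul_assoc]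
      rw [h1, h.P_mul_Dg hP, smul_mul_assoc, mul_assoc, ← mul_assoc A, h.Dg_mul_P hP,
        mul_smul_comm, smul_smul, mul_assoc]
    rw [e, norm_smul, norm_mul, Complex.norm_real, Complex.norm_real, Real.norm_eq_abs,
      Real.norm_eq_abs]
    have := h.bd m n
    calc _ = |f m| * ‖P m * A * P n‖ * |g n| := by ring
      _ ≤ _ := by gcongr

lemma Bd.schur (hP : ProjFamily P) (h : Bd P F k A) {K : ℝ} (hK : 0 ≤ K)
    (hk0 : ∀ m n, 0 ≤ k m n)
    (h1 : ∀ m, ∑ n ∈ F, k m n ≤ K) (h2 : ∀ n, ∑ m ∈ F, k m n ≤ K) : ‖A‖ ≤ K := by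
  refine A.opNorm_le_bound hK fun x => ?_
  refine abs_le_of_sq_le_sq' ?_ (by positivity) |>.2
  have e1 : ‖A x‖ ^ 2 = ∑ m ∈ F, ‖P m (A x)‖ ^ 2 := by
    rw [← norm_PF_sq hP]
    congr 2
    exact (congrArg (fun B : 𝓗 →L[ℂ] 𝓗 => B x) h.left).symm
  have e2 : ∀ m, ‖P m (A x)‖ ≤ ∑ n ∈ F, k m n * ‖P n x‖ := by
    intro m
    have : P m (A x) = ∑ n ∈ F, (P m * A * P n) (P n x) := by
      have h3 : P m * A = ∑ n ∈ F, (P m * A * P n) * P n := by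
        conv_lhs => rw [← h.right]
        unfold PF Dg
        rw [Finset.mul_sum, Finset.mul_sum]
        refine Finset.sum_congr rfl fun n _ => ?_
        rw [Complex.ofReal_one, one_smul, mul_assoc _ (P n) (P n), PP hP, mul_assoc]
      have := congrArg (fun B : 𝓗 →L[ℂ] 𝓗 => B x) h3
      simpa [sum_apply] using this
    rw [this]
    refine (norm_sum_le _ _).trans (Finset.sum_le_sum fun n _ => ?_)
    exact (P m * A * P n).le_of_opNorm_le (h.bd m n) _
  have e3 : ∀ m, ‖P m (A x)‖ ^ 2 ≤ K * ∑ n ∈ F, k m n * ‖P n x‖ ^ 2 := by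
    intro m
    calc ‖P m (A x)‖ ^ 2 ≤ (∑ n ∈ F, k m n * ‖P n x‖) ^ 2 := by gcongr; exact e2 m
      _ ≤ (∑ n ∈ F, k m n) * (∑ n ∈ F, k m n * ‖P n x‖ ^ 2) :=
          Finset.sum_sq_le_sum_mul_sum_of_sq_le_mul F (fun n _ => hk0 m n)
            (fun n _ => mul_nonneg (hk0 m n) (by positivity)) (fun n _ => le_of_eq (by ring))
      _ ≤ _ := by
          gcongr
          · exact Finset.sum_nonneg fun n _ => mul_nonneg (hk0 m n) (by positivity)
          · exact h1 m
  rw [e1, mul_pow]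
  calc _ ≤ ∑ m ∈ F, K * ∑ n ∈ F, k m n * ‖P n x‖ ^ 2 := Finset.sum_le_sum fun m _ => e3 m
    _ = K * ∑ n ∈ F, (∑ m ∈ F, k m n) * ‖P n x‖ ^ 2 := by
        rw [← Finset.mul_sum, Finset.sum_comm]
        simp only [Finset.sum_mul]
    _ ≤ K * ∑ n ∈ F, K * ‖P n x‖ ^ 2 := by
        gcongr with n hn; exact h2 n
    _ = K ^ 2 * ∑ n ∈ F, ‖P n x‖ ^ 2 := by rw [← Finset.mul_sum]; ring
    _ ≤ _ := by gcongr; exact sum_P_sq_le hP F x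

lemma Bd.integral {f : ℝ → 𝓗 →L[ℂ] 𝓗} (hf : Continuous f) {t : ℝ} (ht : 0 ≤ t)
    (h : ∀ s ∈ Set.Icc 0 t, Bd P F k (f s)) :
    Bd P F (fun m n => t * k m n) (∫ s in (0:ℝ)..t, f s) := by
  have hi : IntervalIntegrable f MeasureTheory.volume 0 t := hf.intervalIntegrable _ _
  have hL : ∀ B : 𝓗 →L[ℂ] 𝓗, B * (∫ s in (0:ℝ)..t, f s) = ∫ s in (0:ℝ)..t, B * f s := fun B =>
    (((ContinuousLinearMap.mul ℝ (𝓗 →L[ℂ] 𝓗)) B).intervalIntegral_comp_comm hi).symm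
  have hR : ∀ (g : ℝ → 𝓗 →L[ℂ] 𝓗) (_ : Continuous g) (B : 𝓗 →L[ℂ] 𝓗),
      (∫ s in (0:ℝ)..t, g s) * B = ∫ s in (0:ℝ)..t, g s * B := fun g hg B =>
    (((ContinuousLinearMap.mul ℝ (𝓗 →L[ℂ] 𝓗)).flip B).intervalIntegral_comp_comm
      (hg.intervalIntegrable 0 t)).symm
  have hs : Set.uIcc 0 t = Set.Icc 0 t := Set.uIcc_of_le ht
  refine ⟨?_, ?_, fun m n => ?_⟩
  · rw [hL]; exact intervalIntegral.integral_congr fun s hs' => (h s (hs ▸ hs')).left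
  · rw [hR f hf]; exact intervalIntegral.integral_congr fun s hs' => (h s (hs ▸ hs')).right
  · rw [hL, hR _ (by fun_prop)]
    have := intervalIntegral.norm_integral_le_of_norm_le_const (a := 0) (b := t) (C := k m n)
      (f := fun s => P m * f s * P n) (fun s hs' => (h s ?_).bd m n)
    · rwa [sub_zero, abs_of_nonneg ht, mul_comm] at this
    · rw [Set.uIoc_of_le ht] at hs'
      exact ⟨hs'.1.le, hs'.2⟩
end bd
end

noncomputable section
open ContinuousLinearMap
set_option linter.unusedSectionVars false

variable {𝓗 : Type*} [NormedAddCommGroup 𝓗] [InnerProductSpace ℂ 𝓗] [CompleteSpace 𝓗]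

def ww (p γ : ℝ) (j : ℕ) : ℕ+ → ℕ+ → ℝ := wt (p - j) (2 * ((j : ℝ) + 1) * γ)
def ee (p γ : ℝ) (j : ℕ) (m n : ℕ+) : ℝ := ∑ i ∈ Finset.range j, ww p γ i m n

lemma ww_nonneg (p γ : ℝ) (j : ℕ) (m n : ℕ+) : 0 ≤ ww p γ j m n := wt_nonneg _ _ _ _
lemma ww_comm (p γ : ℝ) (j : ℕ) (m n : ℕ+) : ww p γ j m n = ww p γ j n m := wt_comm _ _ _ _
lemma ee_nonneg (p γ : ℝ) (j : ℕ) (m n : ℕ+) : 0 ≤ ee p γ j m n :=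
  Finset.sum_nonneg fun _ _ => ww_nonneg _ _ _ _ _
lemma ee_comm (p γ : ℝ) (j : ℕ) (m n : ℕ+) : ee p γ j m n = ee p γ j n m :=
  Finset.sum_congr rfl fun _ _ => ww_comm _ _ _ _ _

lemma ww_mul {p γ : ℝ} (hγ : 0 < γ) (hγ2 : 2 * γ ≤ 1) {i j : ℕ} (hij : i ≤ j)
    (hj : 1 < p - ((j + 1 : ℕ) : ℝ)) :
    ∃ K > 0, ∀ (F : Finset ℕ+) (m n : ℕ+),
      ∑ l ∈ F, ww p γ i m l * ww p γ j l n ≤ K * ww p γ (j + 1) m n := by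
  have hij' : (i : ℝ) ≤ j := by exact_mod_cast hij
  have hi0 : (0 : ℝ) ≤ i := by positivity
  have hj0 : (0 : ℝ) ≤ j := by positivity
  unfold ww
  push_cast at hj ⊢
  refine wt_mul hj (by linarith) (by linarith) (by positivity) (by positivity)
    (by nlinarith) (by nlinarith) (by nlinarith) (by nlinarith) (by nlinarith)

lemma ee_mul {p γ : ℝ} (hγ : 0 < γ) (hγ2 : 2 * γ ≤ 1) {j : ℕ}
    (hj : 1 < p - ((j + 1 : ℕ) : ℝ)) :
    ∃ K > 0, ∀ (F : Finset ℕ+) (m n : ℕ+),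
      ∑ l ∈ F, ee p γ (j + 1) m l * ww p γ j l n ≤ K * ww p γ (j + 1) m n := by
  have : ∀ i, ∃ K > 0, i ≤ j → ∀ (F : Finset ℕ+) (m n : ℕ+),
      ∑ l ∈ F, ww p γ i m l * ww p γ j l n ≤ K * ww p γ (j + 1) m n := by
    intro i
    by_cases h : i ≤ j
    · obtain ⟨K, h1, h2⟩ := ww_mul hγ hγ2 h hj
      exact ⟨K, h1, fun _ => h2⟩
    · exact ⟨1, one_pos, fun h' => absurd h' h⟩
  choose K hK h using this
  refine ⟨∑ i ∈ Finset.range (j + 1), K i, Finset.sum_pos (fun i _ => hK i) (by simp), ?_⟩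
  intro F m n
  unfold ee
  simp only [Finset.sum_mul]
  rw [Finset.sum_comm]
  refine Finset.sum_le_sum fun i hi => h i ?_ F m n
  have := Finset.mem_range.1 hi
  omega

structure Sc (P : ℕ+ → 𝓗 →L[ℂ] 𝓗) (p γ T : ℝ) where
  F : Finset ℕ+
  V : ℝ → 𝓗 →L[ℂ] 𝓗
  τ : ℝ
  hτ : 0 < τ
  hτT : τ ≤ T
  hV : Continuous V
  hVsa : ∀ t, star (V t) = V t
  hVb : ∀ t, Bd P F (ww p γ 0) (V t)

variable {P : ℕ+ → 𝓗 →L[ℂ] 𝓗} {p γ T : ℝ}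

def OK (k : ℕ+ → ℕ+ → ℝ) (f : Sc P p γ T → ℝ → 𝓗 →L[ℂ] 𝓗) : Prop :=
  ∃ C, 0 ≤ C ∧ ∀ x : Sc P p γ T, ∀ t ∈ Set.Icc 0 x.τ, Bd P x.F (fun m n => C * k m n) (f x t)

section rules
variable {k k1 k2 : ℕ+ → ℕ+ → ℝ} {f g : Sc P p γ T → ℝ → 𝓗 →L[ℂ] 𝓗}

lemma OK.add (hf : OK k f) (hg : OK k g) : OK k (fun x t => f x t + g x t) := by
  obtain ⟨C, h0, h⟩ := hf
  obtain ⟨D, h0', h'⟩ := hg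
  exact ⟨C + D, by positivity, fun x t ht => ((h x t ht).add (h' x t ht)).mono
    fun m n => by rw [add_mul]⟩

lemma OK.smul (c : ℂ) (hf : OK k f) : OK k (fun x t => c • f x t) := by
  obtain ⟨C, h0, h⟩ := hf
  exact ⟨‖c‖ * C, by positivity, fun x t ht => ((h x t ht).smul c).mono
    fun m n => by rw [mul_assoc]⟩

lemma OK.neg (hf : OK k f) : OK k (fun x t => - f x t) := by
  obtain ⟨C, h0, h⟩ := hf
  exact ⟨C, h0, fun x t ht => (h x t ht).neg⟩

lemma OK.sub (hf : OK k f) (hg : OK k g) : OK k (fun x t => f x t - g x t) := by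
  simp only [sub_eq_add_neg]; exact hf.add hg.neg

lemma OK.star (hP : ProjFamily P) (hk : ∀ m n, k m n = k n m) (hf : OK k f) :
    OK k (fun x t => star (f x t)) := by
  obtain ⟨C, h0, h⟩ := hf
  exact ⟨C, h0, fun x t ht => (h x t ht).star hP fun m n => by rw [hk]⟩

lemma OK.mono (hf : OK k1 f) (h : ∀ m n, k1 m n ≤ k m n) : OK k f := by
  obtain ⟨C, h0, h'⟩ := hf
  exact ⟨C, h0, fun x t ht => (h' x t ht).mono fun m n => by have := h m n; gcongr⟩

lemma OK.mul (hP : ProjFamily P) (hf : OK k1 f) (hg : OK k2 g)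
    (hk : ∃ K > 0, ∀ (F : Finset ℕ+) (m n : ℕ+), ∑ l ∈ F, k1 m l * k2 l n ≤ K * k m n) :
    OK k (fun x t => f x t * g x t) := by
  obtain ⟨C, h0, h⟩ := hf
  obtain ⟨D, h0', h'⟩ := hg
  obtain ⟨K, hK, hk⟩ := hk
  refine ⟨C * D * K, by positivity, fun x t ht => (h x t ht).mul hP (h' x t ht) fun m n => ?_⟩
  calc _ = C * D * ∑ l ∈ x.F, k1 m l * k2 l n := by
        rw [Finset.mul_sum]; exact Finset.sum_congr rfl fun l _ => by ring
    _ ≤ C * D * (K * k m n) := by have := hk x.F m n; gcongr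
    _ = _ := by ring

lemma OK.integral (hk0 : ∀ m n, 0 ≤ k m n) (hf : OK k f) (hc : ∀ x, Continuous (f x)) :
    OK k (fun x t => ∫ s in (0:ℝ)..t, f x s) := by
  obtain ⟨C, h0, h⟩ := hf
  refine ⟨|T| * C, by positivity, fun x t ht => ((Bd.integral (hc x) ht.1
    fun s hs => h x s ⟨hs.1, hs.2.trans ht.2⟩)).mono fun m n => ?_⟩
  have : t ≤ |T| := (ht.2.trans x.hτT).trans (le_abs_self _)
  have := hk0 m n
  calc t * (C * k m n) ≤ |T| * (C * k m n) := by gcongr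
    _ = _ := by ring

lemma OK.avg (hf : OK k f) (hc : ∀ x, Continuous (f x)) :
    OK k (fun x _ => ((x.τ : ℂ)⁻¹) • ∫ s in (0:ℝ)..x.τ, f x s) := by
  obtain ⟨C, h0, h⟩ := hf
  refine ⟨C, by positivity, fun x t ht => (((Bd.integral (hc x) x.hτ.le
    fun s hs => h x s hs)).smul _).mono fun m n => ?_⟩
  rw [norm_inv, Complex.norm_real, Real.norm_eq_abs, abs_of_pos x.hτ]
  have := x.hτ
  apply le_of_eq; field_simp
end rules

lemma OK.comm (hP : ProjFamily P) {E : ℕ+ → ℝ} {CH : ℝ} (hCH : 0 ≤ CH)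
    (hE : ∀ m n, |E m - E n| ≤ CH * jp m n * mx m n ^ (-(2 * γ))) {j : ℕ}
    {f : Sc P p γ T → ℝ → 𝓗 →L[ℂ] 𝓗} (hf : OK (ww p γ j) f) :
    OK (ww p γ (j + 1)) (fun x t => f x t * Dg P x.F E - Dg P x.F E * f x t) := by
  obtain ⟨C, h0, h⟩ := hf
  refine ⟨CH * C, by positivity, fun x t ht => (h x t ht).comm hP E fun m n => ?_⟩
  have h1 : ww p γ (j + 1) m n = jp m n * mx m n ^ (-(2 * γ)) * ww p γ j m n := by
    unfold ww wt
    have e1 : jp m n ^ (-(p - ((j + 1 : ℕ) : ℝ))) = jp m n * jp m n ^ (-(p - (j : ℝ))) := by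
      rw [show -(p - ((j + 1 : ℕ) : ℝ)) = 1 + -(p - (j : ℝ)) by push_cast; ring,
        Real.rpow_add (jp_pos m n), Real.rpow_one]
    have e2 : mx m n ^ (-(2 * (((j + 1 : ℕ) : ℝ) + 1) * γ)) =
        mx m n ^ (-(2 * γ)) * mx m n ^ (-(2 * ((j : ℝ) + 1) * γ)) := by
      rw [← Real.rpow_add (mx_pos m n)]; congr 1; push_cast; ring
    rw [e1, e2]; ring
  rw [h1]
  have := hE m n
  have h2 := ww_nonneg p γ j m n
  calc _ ≤ CH * jp m n * mx m n ^ (-(2 * γ)) * (C * ww p γ j m n) := by gcongr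
    _ = _ := by ring

end

noncomputable section
open ContinuousLinearMap
set_option linter.unusedSectionVars false

variable {𝓗 : Type*} [NormedAddCommGroup 𝓗] [InnerProductSpace ℂ 𝓗] [CompleteSpace 𝓗]
variable {P : ℕ+ → 𝓗 →L[ℂ] 𝓗} {p γ T : ℝ}

structure IndS (E : ℕ+ → ℝ) (j : ℕ) (X R : Sc P p γ T → ℝ → 𝓗 →L[ℂ] 𝓗)
    (Z : Sc P p γ T → 𝓗 →L[ℂ] 𝓗) : Prop where
  Zs : ∀ x, star (Z x) = Z x
  X0 : ∀ x, X x 0 = 0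
  Xτ : ∀ x, X x x.τ = 0
  Rc : ∀ x, Continuous (R x)
  ode : ∀ x t, HasDerivAt (X x) (Complex.I • (x.V t - Z x + (X x t * Dg P x.F E -
    Dg P x.F E * X x t) + X x t * x.V t - Z x * X x t - R x t)) t
  Zo : OK (ee p γ j) (fun x _ => Z x)
  Xo : OK (ee p γ j) X
  Ro : OK (ww p γ j) R
  So : OK (ww p γ j) (fun x t => X x t + star (X x t) + X x t * star (X x t))

lemma ind_base (E : ℕ+ → ℝ) : IndS (P := P) (p := p) (γ := γ) (T := T) E 0 (fun _ _ => 0)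
    (fun x => x.V) (fun _ => 0) := by
  have h0 : ∀ k : ℕ+ → ℕ+ → ℝ, (∀ m n, 0 ≤ k m n) →
      OK k (fun (_ : Sc P p γ T) _ => (0 : 𝓗 →L[ℂ] 𝓗)) := fun k hk =>
    ⟨0, le_rfl, fun x t _ => Bd.zero fun m n => by simp⟩
  refine ⟨by simp, by simp, by simp, fun x => x.hV, fun x t => ?_, ?_, ?_, ?_, ?_⟩
  · simpa using hasDerivAt_const t (0 : 𝓗 →L[ℂ] 𝓗)
  · exact h0 _ (ee_nonneg p γ 0)
  · exact h0 _ (ee_nonneg p γ 0)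
  · exact ⟨1, zero_le_one, fun x t _ => (x.hVb t).mono fun m n => by rw [one_mul]⟩
  · simpa using h0 _ (ww_nonneg p γ 0)

lemma OK.congr {k : ℕ+ → ℕ+ → ℝ} {f g : Sc P p γ T → ℝ → 𝓗 →L[ℂ] 𝓗} (hf : OK k f)
    (h : ∀ x t, t ∈ Set.Icc 0 x.τ → g x t = f x t) : OK k g := by
  obtain ⟨C, h0, h'⟩ := hf
  exact ⟨C, h0, fun x t ht => by rw [h x t ht]; exact h' x t ht⟩

lemma star_int {f : ℝ → 𝓗 →L[ℂ] 𝓗} (hf : Continuous f) (a b : ℝ) :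
    star (∫ s in a..b, f s) = ∫ s in a..b, star (f s) := by
  have := (((starL' ℝ : (𝓗 →L[ℂ] 𝓗) ≃L[ℝ] (𝓗 →L[ℂ] 𝓗)) :
    (𝓗 →L[ℂ] 𝓗) →L[ℝ] (𝓗 →L[ℂ] 𝓗)).intervalIntegral_comp_comm (hf.intervalIntegrable (μ := MeasureTheory.volume) a b))
  exact this.symm

lemma ind_step (hP : ProjFamily P) (hγ : 0 < γ) (hγ2 : 2 * γ ≤ 1) {E : ℕ+ → ℝ} {CH : ℝ}
    (hCH : 0 ≤ CH) (hE : ∀ m n, |E m - E n| ≤ CH * jp m n * mx m n ^ (-(2 * γ))) {j : ℕ}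
    (hj : 1 < p - ((j + 1 : ℕ) : ℝ))
    {X R : Sc P p γ T → ℝ → 𝓗 →L[ℂ] 𝓗} {Z : Sc P p γ T → 𝓗 →L[ℂ] 𝓗}
    (h : IndS E j X R Z) : ∃ X' R' Z', IndS (P := P) (p := p) (γ := γ) (T := T) E (j + 1) X' R' Z' := by
  have hmul := ee_mul (p := p) hγ hγ2 hj
  have hmul' : ∃ K > 0, ∀ (F : Finset ℕ+) (m n : ℕ+),
      ∑ l ∈ F, ww p γ j m l * ee p γ (j + 1) l n ≤ K * ww p γ (j + 1) m n := by
    obtain ⟨K, hK, hk⟩ := hmul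
    refine ⟨K, hK, fun F m n => ?_⟩
    rw [ww_comm]
    refine le_trans (le_of_eq ?_) (hk F n m)
    refine Finset.sum_congr rfl fun l _ => ?_
    rw [ww_comm, ee_comm p γ _ l n, mul_comm]
  have hee : ∀ m n, ee p γ j m n ≤ ee p γ (j + 1) m n := fun m n => by
    unfold ee; rw [Finset.sum_range_succ]; linarith [ww_nonneg p γ j m n]
  have hwe : ∀ m n, ww p γ j m n ≤ ee p γ (j + 1) m n := fun m n => by
    have := ee_nonneg p γ j m n
    unfold ee at this ⊢; rw [Finset.sum_range_succ]; linarith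
  have hVe : OK (ee p γ (j + 1)) (fun x : Sc P p γ T => x.V) := by
    refine ⟨1, zero_le_one, fun x t _ => (x.hVb t).mono fun m n => ?_⟩
    rw [one_mul]
    unfold ee
    exact Finset.single_le_sum (f := fun i => ww p γ i m n) (fun i _ => ww_nonneg _ _ _ _ _)
      (Finset.mem_range.2 (Nat.succ_pos j))
  have hXc : ∀ x, Continuous (X x) := fun x =>
    continuous_iff_continuousAt.2 fun t => (h.ode x t).continuousAt
  have hXe : OK (ee p γ (j + 1)) X := h.Xo.mono hee
  have hXse := hXe.star hP (ee_comm p γ (j + 1))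
  have hRs := h.Ro.star hP (ww_comm p γ j)
  have hZe : OK (ee p γ (j + 1)) (fun x _ => Z x) := h.Zo.mono hee
  let Rb : Sc P p γ T → 𝓗 →L[ℂ] 𝓗 := fun x => ((x.τ : ℂ)⁻¹) • ∫ s in (0:ℝ)..x.τ, R x s
  have hRb : OK (ww p γ j) (fun x _ => Rb x) := h.Ro.avg h.Rc
  let Rh : Sc P p γ T → 𝓗 →L[ℂ] 𝓗 := fun x => (1/2 : ℂ) • (Rb x + star (Rb x))
  let Ra : Sc P p γ T → 𝓗 →L[ℂ] 𝓗 := fun x => (1/2 : ℂ) • (Rb x - star (Rb x))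
  have hRbs := hRb.star hP (ww_comm p γ j)
  have hRh : OK (ww p γ j) (fun x _ => Rh x) := (hRb.add hRbs).smul _
  have hRha : ∀ x, Rb x = Rh x + Ra x := fun x => by
    simp only [Rh, Ra]; rw [← smul_add]
    rw [show Rb x + star (Rb x) + (Rb x - star (Rb x)) = (2:ℂ) • Rb x by rw [two_smul]; abel,
      smul_smul]; norm_num
  have hRhs : ∀ x, star (Rh x) = Rh x := fun x => by
    simp only [Rh]; rw [star_smul, star_add, star_star, add_comm]; simp
  have hRd : ∀ x, Rb x - star (Rb x) = (2 : ℂ) • Ra x := fun x => by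
    simp only [Ra]; rw [smul_smul]; norm_num
  let S : Sc P p γ T → ℝ → 𝓗 →L[ℂ] 𝓗 := fun x t => X x t + star (X x t) + X x t * star (X x t)
  let Q : Sc P p γ T → ℝ → 𝓗 →L[ℂ] 𝓗 := fun x t =>
    (Dg P x.F E + Z x) * S x t - S x t * (Dg P x.F E + Z x) + R x t * star (X x t)
      - X x t * star (R x t)
  have hQc : ∀ x, Continuous (Q x) := fun x => by
    have h1 := hXc x; have h2 := h.Rc x
    simp only [Q, S]; fun_prop
  have hSo : OK (ww p γ j) S := h.So
  have hQ : OK (ww p γ (j + 1)) Q := by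
    refine OK.congr (((((hSo.comm hP hCH hE).neg.add (hZe.mul hP hSo hmul)).sub
      (hSo.mul hP hZe hmul')).add (h.Ro.mul hP hXse hmul')).sub (hXe.mul hP hRs hmul)) ?_
    intro x t _
    simp only [Q]; noncomm_ring
  have hSd : ∀ x t, HasDerivAt (S x) (-(Complex.I • (Q x t + R x t - star (R x t)))) t := by
    intro x t
    have h1 := h.ode x t
    have h2 := h1.star
    have h3 := (h1.add h2).add (h1.mul h2)
    refine h3.congr_deriv ?_
    have eH := Dg_star hP x.F E
    have eV := x.hVsa t
    have eZ := h.Zs x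
    simp only [star_smul, star_add, star_sub, star_mul, eH, eV, eZ, Complex.star_def,
      Complex.conj_I, Q, S]
    simp only [smul_mul_assoc, neg_smul, mul_neg, mul_smul_comm]
    simp only [← smul_neg, ← smul_add]
    congr 1
    noncomm_ring
  have hRac : ∀ x, (2 : ℂ) • Ra x = - ((x.τ : ℂ)⁻¹ • ∫ s in (0:ℝ)..x.τ, Q x s) := by
    intro x
    have hτ : (x.τ : ℂ) ≠ 0 := by exact_mod_cast x.hτ.ne'
    have hRc := h.Rc x
    have hQc' := hQc x
    have hc : Continuous fun t => -(Complex.I • (Q x t + R x t - star (R x t))) := by fun_prop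
    have h1 := intervalIntegral.integral_eq_sub_of_hasDerivAt (a := 0) (b := x.τ)
      (fun t _ => hSd x t) (hc.intervalIntegrable _ _)
    have h2 : S x x.τ - S x 0 = 0 := by simp only [S]; rw [h.X0, h.Xτ]; simp
    rw [h2] at h1
    rw [intervalIntegral.integral_neg, intervalIntegral.integral_smul, neg_eq_zero,
      smul_eq_zero_iff_right Complex.I_ne_zero, intervalIntegral.integral_sub,
      intervalIntegral.integral_add, ← star_int hRc] at h1
    · rw [← hRd]
      simp only [Rb]
      rw [star_smul, show star ((x.τ : ℂ)⁻¹) = (x.τ : ℂ)⁻¹ by simp, ← smul_sub, ← smul_neg]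
      congr 1
      rw [← sub_eq_zero, ← h1]; abel
    all_goals exact Continuous.intervalIntegrable (by fun_prop) _ _
  have hRa : OK (ww p γ (j + 1)) (fun x _ => Ra x) := by
    refine OK.congr ((hQ.avg hQc).smul (-(1/2))) fun x t _ => ?_
    have := congrArg (fun y => (1/2 : ℂ) • y) (hRac x)
    simp only [smul_smul, smul_neg] at this
    rw [show (1/2 : ℂ) * 2 = 1 by norm_num, one_smul] at this
    rw [this, smul_smul, neg_mul, neg_smul]
  let Y : Sc P p γ T → ℝ → 𝓗 →L[ℂ] 𝓗 := fun x t =>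
    Complex.I • ∫ s in (0:ℝ)..t, (R x s - Rb x)
  have hYd : ∀ x t, HasDerivAt (Y x) (Complex.I • (R x t - Rb x)) t := fun x t => by
    have hc : Continuous fun s => R x s - Rb x := (h.Rc x).sub continuous_const
    have := (hc.integral_hasStrictDerivAt 0 t).hasDerivAt
    exact this.const_smul Complex.I
  have hYc : ∀ x, Continuous (Y x) := fun x =>
    continuous_iff_continuousAt.2 fun t => (hYd x t).continuousAt
  have hY : OK (ww p γ j) Y :=
    ((h.Ro.sub hRb).integral (ww_nonneg p γ j) fun x => (h.Rc x).sub continuous_const).smul _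
  have hYs := hY.star hP (ww_comm p γ j)
  have hY0 : ∀ x, Y x 0 = 0 := fun x => by simp [Y]
  have hYτ : ∀ x, Y x x.τ = 0 := fun x => by
    have hτ : (x.τ : ℂ) ≠ 0 := by exact_mod_cast x.hτ.ne'
    simp only [Y]
    rw [intervalIntegral.integral_sub ((h.Rc x).intervalIntegrable _ _)
      (continuous_const.intervalIntegrable _ _), intervalIntegral.integral_const]
    simp only [Rb]
    rw [sub_zero, ← Complex.coe_smul, smul_smul, mul_inv_cancel₀ hτ, one_smul, sub_self, smul_zero]
  have hD : OK (ww p γ (j + 1)) (fun x t => S x t + Y x t + star (Y x t)) := by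
    have h1 : OK (ww p γ (j + 1)) (fun x t => -(Complex.I • (Q x t + (2:ℂ) • Ra x))) :=
      ((hQ.add (hRa.smul 2)).smul _).neg
    have hc1 : ∀ x, Continuous fun t => -(Complex.I • (Q x t + (2:ℂ) • Ra x)) := fun x => by
      have := hQc x; fun_prop
    refine OK.congr (h1.integral (ww_nonneg p γ (j + 1)) hc1) fun x t _ => ?_
    have hd : ∀ t, HasDerivAt (fun t => S x t + Y x t + star (Y x t))
        (-(Complex.I • (Q x t + (2:ℂ) • Ra x))) t := fun t => by
      refine ((hSd x t).add (hYd x t)).add (hYd x t).star |>.congr_deriv ?_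
      rw [← hRd]
      simp only [star_smul, star_sub, Complex.star_def, Complex.conj_I, neg_smul]
      simp only [← smul_neg, ← smul_add]
      congr 1
      abel
    have := intervalIntegral.integral_eq_sub_of_hasDerivAt (a := 0) (b := t)
      (fun t _ => hd t) ((hc1 x).intervalIntegrable _ _)
    rw [this]
    simp [hY0, S, h.X0]
  have hYe := hY.mono hwe
  have hZ' : OK (ee p γ (j + 1)) (fun x _ => Z x + Rh x) := hZe.add (hRh.mono hwe)
  refine ⟨fun x t => X x t + Y x t, fun x t => Ra x + (Y x t * Dg P x.F E - Dg P x.F E * Y x t)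
    + Y x t * x.V t - (Z x + Rh x) * Y x t - Rh x * X x t, fun x => Z x + Rh x, ?_⟩
  refine ⟨fun x => by rw [star_add, h.Zs, hRhs], fun x => by rw [h.X0, hY0, add_zero],
    fun x => by rw [h.Xτ, hYτ, add_zero], fun x => ?_, fun x t => ?_, hZ', hXe.add hYe, ?_, ?_⟩
  · have := hYc x; have := hXc x; have := x.hV
    fun_prop
  · refine ((h.ode x t).add (hYd x t)).congr_deriv ?_
    rw [← smul_add]
    congr 1
    rw [hRha]
    noncomm_ring
  · exact ((((hRa.add (hY.comm hP hCH hE)).add (hY.mul hP hVe hmul')).sub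
      (hZ'.mul hP hY hmul)).sub (hRh.mul hP hXe hmul'))
  · refine OK.congr (((hD.add (hY.mul hP hXse hmul')).add (hXe.mul hP hYs hmul)).add
      (hYe.mul hP hYs hmul)) fun x t _ => ?_
    simp only [S, star_add]
    noncomm_ring

lemma ind_all (hP : ProjFamily P) (hγ : 0 < γ) (hγ2 : 2 * γ ≤ 1) {E : ℕ+ → ℝ} {CH : ℝ}
    (hCH : 0 ≤ CH) (hE : ∀ m n, |E m - E n| ≤ CH * jp m n * mx m n ^ (-(2 * γ))) {q : ℕ}
    (hq : 1 < p - (q : ℝ)) : ∀ j ≤ q,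
    ∃ X R Z, IndS (P := P) (p := p) (γ := γ) (T := T) E j X R Z := by
  intro j
  induction j with
  | zero => intro _; exact ⟨_, _, _, ind_base E⟩
  | succ j ih =>
    intro hj
    obtain ⟨X, R, Z, h⟩ := ih (by omega)
    refine ind_step hP hγ hγ2 hCH hE ?_ h
    have : ((j + 1 : ℕ) : ℝ) ≤ q := by exact_mod_cast hj
    linarith

end

noncomputable section
open ContinuousLinearMap
set_option linter.unusedSectionVars false

variable {𝓗 : Type*} [NormedAddCommGroup 𝓗] [InnerProductSpace ℂ 𝓗] [CompleteSpace 𝓗]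

lemma sa_inner {A : 𝓗 →L[ℂ] 𝓗} (hA : star A = A) (x y : 𝓗) :
    inner ℂ (A x) y = inner ℂ x (A y) := by
  have := ContinuousLinearMap.adjoint_inner_left A y x
  rwa [← ContinuousLinearMap.star_eq_adjoint, hA] at this

lemma sqrt_op {A : 𝓗 →L[ℂ] 𝓗} (hA : star A = A) (hpos : ∀ x, 0 ≤ (inner ℂ (A x) x).re) :
    ∃ S : 𝓗 →L[ℂ] 𝓗, star S = S ∧ S * S = A ∧ ∀ B, Commute A B → Commute S B := by
  have h0 : 0 ≤ A := by
    rw [ContinuousLinearMap.nonneg_iff_isPositive]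
    exact ⟨fun x y => sa_inner hA x y, hpos⟩
  refine ⟨CFC.sqrt A, (IsSelfAdjoint.of_nonneg (CFC.sqrt_nonneg A)), CFC.sqrt_mul_sqrt_self A h0,
    fun B hB => ?_⟩
  rw [CFC.sqrt_eq_cfc]
  exact hB.cfc_nnreal _

lemma interp {S : 𝓗 →L[ℂ] 𝓗} (hS : star S = S) (Y : 𝓗) {l : ℝ} (hl : 0 < l) (i : ℕ) :
    ‖S Y‖ ^ 2 ≤ l * ‖Y‖ ^ 2 + (l ^ i)⁻¹ * ‖(S ^ (i + 1)) Y‖ ^ 2 := by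
  have hlc : ∀ k : ℕ, (‖(S ^ (k + 1)) Y‖ ^ 2) ^ 2 ≤ ‖(S ^ k) Y‖ ^ 2 * ‖(S ^ (k + 2)) Y‖ ^ 2 := by
    intro k
    have e1 : (S ^ (k + 1)) Y = S ((S ^ k) Y) := by rw [pow_succ']; rfl
    have e2 : (S ^ (k + 2)) Y = S ((S ^ (k + 1)) Y) := by rw [pow_succ' S (k + 1)]; rfl
    have h1 : ‖(S ^ (k + 1)) Y‖ ^ 2 ≤ ‖(S ^ k) Y‖ * ‖(S ^ (k + 2)) Y‖ := by
      have h2 : inner ℂ ((S ^ (k + 1)) Y) ((S ^ (k + 1)) Y) =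
          inner ℂ ((S ^ k) Y) ((S ^ (k + 2)) Y) := by
        rw [e2]; conv_lhs => rw [e1]
        rw [sa_inner hS, e1]
      have h3 := norm_inner_le_norm (𝕜 := ℂ) ((S ^ k) Y) ((S ^ (k + 2)) Y)
      rw [← h2, inner_self_eq_norm_sq_to_K] at h3
      simpa using h3
    rw [← mul_pow]
    gcongr
  by_cases hc : ‖S Y‖ ^ 2 ≤ l * ‖Y‖ ^ 2
  · have : 0 ≤ (l ^ i)⁻¹ * ‖(S ^ (i + 1)) Y‖ ^ 2 := by positivity
    linarith
  push Not at hc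
  have key : ∀ k : ℕ, 0 < ‖(S ^ (k + 1)) Y‖ ^ 2 ∧
      l * ‖(S ^ k) Y‖ ^ 2 ≤ ‖(S ^ (k + 1)) Y‖ ^ 2 ∧
      l ^ k * ‖S Y‖ ^ 2 ≤ ‖(S ^ (k + 1)) Y‖ ^ 2 := by
    intro k
    induction k with
    | zero =>
      simp only [zero_add, pow_one, pow_zero, one_mul]
      exact ⟨lt_of_le_of_lt (by positivity) hc, hc.le, le_rfl⟩
    | succ k ih =>
      obtain ⟨h1, h2, h3⟩ := ih
      have h4 := hlc k
      have h5 : 0 < ‖(S ^ k) Y‖ ^ 2 := by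
        rcases (sq_nonneg ‖(S ^ k) Y‖).eq_or_lt with h | h
        · rw [← h, zero_mul] at h4
          have : 0 < (‖(S ^ (k + 1)) Y‖ ^ 2) ^ 2 := by positivity
          linarith
        · exact h
      have h6 : l * ‖(S ^ (k + 1)) Y‖ ^ 2 ≤ ‖(S ^ (k + 1 + 1)) Y‖ ^ 2 := by
        refine le_of_mul_le_mul_left ?_ h5
        refine le_trans ?_ h4
        nlinarith
      refine ⟨lt_of_lt_of_le (by positivity) h6, h6, le_trans ?_ h6⟩
      rw [pow_succ' l k, mul_assoc]
      gcongr
  have h := (key i).2.2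
  have h2 : ‖S Y‖ ^ 2 ≤ (l ^ i)⁻¹ * ‖(S ^ (i + 1)) Y‖ ^ 2 := by
    rw [inv_mul_eq_div, le_div_iff₀ (by positivity)]; linarith
  have : 0 ≤ l * ‖Y‖ ^ 2 := by positivity
  linarith

lemma interp_t {S : 𝓗 →L[ℂ] 𝓗} (hS : star S = S) {Y : 𝓗} {t C : ℝ} (ht : 0 < t) (hC : 0 ≤ C) {j : ℕ}
    (hj : 1 ≤ j) (h : ‖(S ^ j) Y‖ ≤ C * t) :
    ‖S Y‖ ^ 2 ≤ t ^ ((2 : ℝ) / j) * (‖Y‖ ^ 2 + C ^ 2) := by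
  obtain ⟨i, rfl⟩ : ∃ i, j = i + 1 := ⟨j - 1, by omega⟩
  set l := t ^ ((2 : ℝ) / (i + 1 : ℕ)) with hl
  have hl0 : 0 < l := Real.rpow_pos_of_pos ht _
  have h1 : l ^ i * l = t ^ 2 := by
    rw [← pow_succ, hl, ← Real.rpow_natCast, ← Real.rpow_mul ht.le, ← Real.rpow_natCast t 2]
    congr 1
    have : ((i + 1 : ℕ) : ℝ) ≠ 0 := by positivity
    field_simp; norm_num
  have h2 := interp hS Y hl0 i
  have h3 : (l ^ i)⁻¹ * ‖(S ^ (i + 1)) Y‖ ^ 2 ≤ l * C ^ 2 := by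
    rw [inv_mul_eq_div, div_le_iff₀ (by positivity)]
    calc _ ≤ (C * t) ^ 2 := by gcongr
      _ = C ^ 2 * (l ^ i * l) := by rw [h1]; ring
      _ = _ := by ring
  linarith

def Gm (P : ℕ+ → 𝓗 →L[ℂ] 𝓗) (F : Finset ℕ+) (b : ℝ) : 𝓗 →L[ℂ] 𝓗 :=
  Dg P F (fun n => ((n : ℕ) : ℝ) ^ b)

variable {P : ℕ+ → 𝓗 →L[ℂ] 𝓗} {p γ : ℝ}

lemma Gm_mono (hP : ProjFamily P) (F : Finset ℕ+) {a b : ℝ} (hab : a ≤ b) (x : 𝓗) :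
    ‖Gm P F a x‖ ≤ ‖Gm P F b x‖ := by
  refine abs_le_of_sq_le_sq' ?_ (by positivity) |>.2
  unfold Gm
  rw [norm_Dg_sq hP, norm_Dg_sq hP]
  refine Finset.sum_le_sum fun n _ => ?_
  have := Real.rpow_le_rpow_of_exponent_le (one_le_pn n) hab
  have h0 : 0 ≤ ((n : ℕ) : ℝ) ^ a := by positivity
  gcongr

lemma Gm_zero (F : Finset ℕ+) : Gm P F 0 = PF P F := by
  unfold Gm PF; simp

lemma ww_le {q i : ℕ} (hγ : 0 < γ) (hi : i ≤ q) (m n : ℕ+) : ww p γ i m n ≤ jp m n ^ (-(p - q)) := by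
  have hi' : (i : ℝ) ≤ q := by exact_mod_cast hi
  unfold ww wt
  have h1 : mx m n ^ (-(2 * ((i : ℝ) + 1) * γ)) ≤ 1 :=
    Real.rpow_le_one_of_one_le_of_nonpos (one_le_mx m n) (by simp; positivity)
  have h2 : jp m n ^ (-(p - (i : ℝ))) ≤ jp m n ^ (-(p - q)) :=
    Real.rpow_le_rpow_of_exponent_le (one_le_jp m n) (by linarith)
  have h3 : 0 ≤ jp m n ^ (-(p - (i : ℝ))) := Real.rpow_nonneg (jp_pos m n).le _
  nlinarith

lemma le_mx (m n : ℕ+) : ((m : ℕ) : ℝ) ≤ mx m n := by rw [mx_eq]; exact le_max_left _ _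

lemma kerR {q : ℕ} (hγ : 0 < γ) (m n : ℕ+) :
    ((m : ℕ) : ℝ) ^ (2 * ((q : ℝ) + 1) * γ) * ww p γ q m n ≤ jp m n ^ (-(p - q)) := by
  unfold ww wt
  have h1 : ((m : ℕ) : ℝ) ^ (2 * ((q : ℝ) + 1) * γ) * mx m n ^ (-(2 * ((q : ℝ) + 1) * γ)) ≤ 1 := by
    rw [Real.rpow_neg (mx_pos m n).le, ← div_eq_mul_inv,
      div_le_one (Real.rpow_pos_of_pos (mx_pos m n) _)]
    exact Real.rpow_le_rpow (pn_pos m).le (le_mx m n) (by positivity)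
  have h3 : 0 ≤ jp m n ^ (-(p - (q : ℝ))) := Real.rpow_nonneg (jp_pos m n).le _
  nlinarith

lemma kerZ {q i : ℕ} (hγ : 0 < γ) (hγ2 : 2 * γ ≤ 1) (hi : i < q) {a α s : ℝ} (hα : 0 ≤ α)
    (ha : 0 ≤ a) (hs : s = 2 * ((q : ℝ) + 1) * γ) (has : a + α ≤ s) (hα2 : α = 1 - 2 * γ) (m n : ℕ+) :
    ((m : ℕ) : ℝ) ^ a * ww p γ i m n * ((n : ℕ) : ℝ) ^ (-(a + α)) ≤
      2 ^ s * jp m n ^ (-(p - q)) := by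
  have hi' : (i : ℝ) + 1 ≤ q := by exact_mod_cast hi
  have hs0 : 0 ≤ s := by linarith
  have h2s : (1 : ℝ) ≤ 2 ^ s := Real.one_le_rpow (by norm_num) hs0
  set d := 2 * ((i : ℝ) + 1) * γ with hd
  have hd0 : 0 ≤ d := by positivity
  have hmp := pn_pos m
  have hnp := pn_pos n
  have hjp := jp_pos m n
  have hmxp := mx_pos m n
  by_cases hc : a ≤ d
  · have h1 : ((m : ℕ) : ℝ) ^ a * mx m n ^ (-d) ≤ 1 := by
      rw [Real.rpow_neg hmxp.le, ← div_eq_mul_inv, div_le_one (Real.rpow_pos_of_pos hmxp _)]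
      exact (Real.rpow_le_rpow hmp.le (le_mx m n) ha).trans
        (Real.rpow_le_rpow_of_exponent_le (one_le_mx m n) hc)
    have h2 : ((n : ℕ) : ℝ) ^ (-(a + α)) ≤ 1 :=
      Real.rpow_le_one_of_one_le_of_nonpos (one_le_pn n) (by linarith)
    have h3 : jp m n ^ (-(p - (i : ℝ))) ≤ jp m n ^ (-(p - q)) :=
      Real.rpow_le_rpow_of_exponent_le (one_le_jp m n) (by linarith)
    unfold ww wt
    rw [← hd]
    have e0 : 0 ≤ jp m n ^ (-(p - (i : ℝ))) := by positivity
    calc _ = (((m : ℕ) : ℝ) ^ a * mx m n ^ (-d)) * ((n : ℕ) : ℝ) ^ (-(a + α)) *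
          jp m n ^ (-(p - (i : ℝ))) := by ring
      _ ≤ 1 * 1 * jp m n ^ (-(p - q)) := by gcongr
      _ ≤ 2 ^ s * jp m n ^ (-(p - q)) := by
        rw [one_mul]; gcongr
  · push Not at hc
    have hmm : mx m n ^ (-d) ≤ ((m : ℕ) : ℝ) ^ (-d) :=
      Real.rpow_le_rpow_of_nonpos hmp (le_mx m n) (by linarith)
    have h1 : ((m : ℕ) : ℝ) ^ a * mx m n ^ (-d) ≤ (2 * ((n : ℕ) : ℝ) * jp m n) ^ (a - d) := by
      calc _ ≤ ((m : ℕ) : ℝ) ^ a * ((m : ℕ) : ℝ) ^ (-d) := by gcongr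
        _ = ((m : ℕ) : ℝ) ^ (a - d) := by rw [← Real.rpow_add hmp]; rfl
        _ ≤ _ := Real.rpow_le_rpow hmp.le (pn_le m n) (by linarith)
    rw [Real.mul_rpow (by positivity) hjp.le, Real.mul_rpow (by norm_num) hnp.le] at h1
    have h2 : (2 : ℝ) ^ (a - d) ≤ 2 ^ s :=
      Real.rpow_le_rpow_of_exponent_le (by norm_num) (by linarith)
    have h3 : ((n : ℕ) : ℝ) ^ (a - d) * ((n : ℕ) : ℝ) ^ (-(a + α)) ≤ 1 := by
      rw [← Real.rpow_add hnp]
      exact Real.rpow_le_one_of_one_le_of_nonpos (one_le_pn n) (by linarith)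
    have h4 : jp m n ^ (a - d) * jp m n ^ (-(p - (i : ℝ))) ≤ jp m n ^ (-(p - q)) := by
      rw [← Real.rpow_add hjp]
      refine Real.rpow_le_rpow_of_exponent_le (one_le_jp m n) ?_
      have : a - d ≤ q - i := by
        have : a - d ≤ 2 * ((q : ℝ) - i) * γ := by rw [hd]; nlinarith
        nlinarith
      linarith
    unfold ww wt
    rw [← hd]
    have e0 : 0 ≤ jp m n ^ (-(p - (i : ℝ))) := by positivity
    calc _ = (((m : ℕ) : ℝ) ^ a * mx m n ^ (-d)) * ((n : ℕ) : ℝ) ^ (-(a + α)) *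
          jp m n ^ (-(p - (i : ℝ))) := by ring
      _ ≤ (2 ^ (a - d) * ((n : ℕ) : ℝ) ^ (a - d) * jp m n ^ (a - d)) * ((n : ℕ) : ℝ) ^ (-(a + α)) *
          jp m n ^ (-(p - (i : ℝ))) := by gcongr
      _ = 2 ^ (a - d) * (((n : ℕ) : ℝ) ^ (a - d) * ((n : ℕ) : ℝ) ^ (-(a + α))) *
        (jp m n ^ (a - d) * jp m n ^ (-(p - (i : ℝ)))) := by ring
      _ ≤ 2 ^ s * 1 * jp m n ^ (-(p - q)) := by gcongr
      _ = _ := by ring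

/-- Schur test for kernels dominated by a power of `jp`. -/
lemma schur_jp (hP : ProjFamily P) {r : ℝ} (hr : 1 < r) : ∃ K > 0, ∀ (F : Finset ℕ+) (C : ℝ), 0 ≤ C →
    ∀ A : 𝓗 →L[ℂ] 𝓗, Bd P F (fun m n => C * jp m n ^ (-r)) A → ‖A‖ ≤ C * K := by
  obtain ⟨K, hK, h⟩ := jp_sum hr
  refine ⟨K, hK, fun F C hC A hA => hA.schur hP (by positivity) (fun m n => ?_) (fun m => ?_)
    (fun n => ?_)⟩
  · have := jp_pos m n; positivity
  · rw [← Finset.mul_sum]; have := h F m; gcongr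
  · rw [← Finset.mul_sum]
    have := h F n
    simp only [jp_comm n] at this
    gcongr

end

noncomputable section
open ContinuousLinearMap
set_option linter.unusedSectionVars false

variable {𝓗 : Type*} [NormedAddCommGroup 𝓗] [InnerProductSpace ℂ 𝓗] [CompleteSpace 𝓗]
variable {P : ℕ+ → 𝓗 →L[ℂ] 𝓗} {p γ : ℝ}

lemma Dg_add (F : Finset ℕ+) (f g : ℕ+ → ℝ) : Dg P F (fun n => f n + g n) = Dg P F f + Dg P F g := by
  unfold Dg
  rw [← Finset.sum_add_distrib]
  refine Finset.sum_congr rfl fun n _ => ?_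
  rw [← add_smul]; push_cast; rfl

lemma Gm_neg_mul (hP : ProjFamily P) (F : Finset ℕ+) (b : ℝ) : Gm P F (-b) * Gm P F b = PF P F := by
  unfold Gm PF
  rw [Dg_mul_Dg hP]
  congr 1
  funext n
  rw [← Real.rpow_add (pn_pos n)]; simp

lemma Gm_Dg (hP : ProjFamily P) (F : Finset ℕ+) {E : ℕ+ → ℝ} {CE α a : ℝ} (hCE : 0 ≤ CE)
    (hE0 : ∀ n, 0 < E n) (hE : ∀ n, E n ≤ CE * ((n : ℕ) : ℝ) ^ α) (x : 𝓗) :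
    ‖Gm P F a (Dg P F E x)‖ ≤ CE * ‖Gm P F (a + α) x‖ := by
  refine abs_le_of_sq_le_sq' ?_ (by positivity) |>.2
  have e : Gm P F a (Dg P F E x) = (Gm P F a * Dg P F E) x := rfl
  rw [e]
  unfold Gm
  rw [Dg_mul_Dg hP, norm_Dg_sq hP, mul_pow, norm_Dg_sq hP, Finset.mul_sum]
  refine Finset.sum_le_sum fun n _ => ?_
  have h0 := hE0 n
  have h1 := hE n
  have hn := pn_pos n
  rw [Real.rpow_add hn]
  calc _ ≤ (((n : ℕ) : ℝ) ^ a * (CE * ((n : ℕ) : ℝ) ^ α)) ^ 2 * ‖P n x‖ ^ 2 := by gcongr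
    _ = _ := by ring

lemma core_ops (hP : ProjFamily P) (hγ : 0 < γ) (hγ2 : 2 * γ ≤ 1) {q : ℕ} (hq : 1 < p - (q : ℝ))
    {E : ℕ+ → ℝ} {CE α s CZ CR : ℝ} (hα : α = 1 - 2 * γ) (hCE : 0 ≤ CE)
    (hs : s = 2 * ((q : ℝ) + 1) * γ)
    (hE0 : ∀ n, 0 < E n) (hE : ∀ n, E n ≤ CE * ((n : ℕ) : ℝ) ^ α) (hCZ : 0 ≤ CZ) (hCR : 0 ≤ CR)
    {j : ℕ} (hj : (j : ℝ) * α / 2 ≤ s) :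
    ∃ c M : ℝ, 0 ≤ c ∧ 0 ≤ M ∧ ∀ (F : Finset ℕ+) (Z : 𝓗 →L[ℂ] 𝓗), star Z = Z →
      Bd P F (fun m n => CZ * ee p γ q m n) Z →
      ∃ S : 𝓗 →L[ℂ] 𝓗, star S = S ∧ (∀ B, Commute (Dg P F E + Z) B → Commute S B) ∧
        (∀ x, ∑ n ∈ F, E n * ‖P n x‖ ^ 2 ≤ ‖S x‖ ^ 2) ∧
        (∀ x, ‖S x‖ ^ 2 ≤ ∑ n ∈ F, E n * ‖P n x‖ ^ 2 + 2 * c * ‖x‖ ^ 2) ∧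
        ∀ R, Bd P F (fun m n => CR * ww p γ q m n) R → ∀ φ, ‖(S ^ j) (R φ)‖ ≤ M * ‖φ‖ := by
  obtain ⟨K, hK, hsch⟩ := schur_jp (𝓗 := 𝓗) hP hq
  have hα0 : 0 ≤ α := by linarith
  have hs0 : 0 ≤ s := by rw [hs]; positivity
  set c := CZ * q * K with hc
  have hc0 : 0 ≤ c := by positivity
  set MA := CE + CZ * (q * 2 ^ s) * K + c with hMA
  have hMA0 : 0 ≤ MA := by positivity
  refine ⟨c, (CE + 2 * c + 1) * (MA + 1) ^ j * (CR * K), hc0, by positivity, fun F Z hZs hZ => ?_⟩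
  have hZn : ‖Z‖ ≤ c := by
    refine hsch F (CZ * q) (by positivity) Z (hZ.mono fun m n => ?_)
    have : ee p γ q m n ≤ q * jp m n ^ (-(p - q)) := by
      unfold ee
      have := Finset.sum_le_card_nsmul (Finset.range q) (fun i => ww p γ i m n)
        (jp m n ^ (-(p - q))) fun i hi => ww_le hγ (Finset.mem_range.1 hi).le m n
      simpa using this
    rw [mul_assoc]
    gcongr
  set A : 𝓗 →L[ℂ] 𝓗 := Dg P F E + Z + (c : ℂ) • 1 with hA
  have hAs : star A = A := by
    rw [hA, star_add, star_add, Dg_star hP, hZs, star_smul]; simp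
  have hAin : ∀ x, (inner ℂ (A x) x).re = ∑ n ∈ F, E n * ‖P n x‖ ^ 2 + (inner ℂ (Z x) x).re
      + c * ‖x‖ ^ 2 := fun x => by
    have : A x = Dg P F E x + Z x + (c : ℂ) • x := rfl
    rw [this, inner_add_left, inner_add_left, inner_Dg hP, inner_smul_left,
      inner_self_eq_norm_sq_to_K]
    simp only [Complex.add_re, Complex.ofReal_re, Complex.conj_ofReal]
    congr 1
    norm_cast
    rw [Complex.re_ofReal_mul]; rfl
  have hZin : ∀ x, |(inner ℂ (Z x) x).re| ≤ c * ‖x‖ ^ 2 := fun x => by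
    calc _ ≤ ‖inner ℂ (Z x) x‖ := Complex.abs_re_le_norm _
      _ ≤ ‖Z x‖ * ‖x‖ := norm_inner_le_norm _ _
      _ ≤ (c * ‖x‖) * ‖x‖ := by
        gcongr; exact Z.le_of_opNorm_le hZn x
      _ = _ := by ring
  have hEn0 : ∀ x, 0 ≤ ∑ n ∈ F, E n * ‖P n x‖ ^ 2 := fun x =>
    Finset.sum_nonneg fun n _ => by have := hE0 n; positivity
  obtain ⟨S, hSs, hSS, hSc⟩ := sqrt_op hAs fun x => by
    rw [hAin]
    have := (abs_le.1 (hZin x)).1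
    have := hEn0 x
    linarith
  have hSn : ∀ x, ‖S x‖ ^ 2 = (inner ℂ (A x) x).re := fun x => by
    rw [← hSS]
    have : inner ℂ ((S * S) x) x = inner ℂ (S x) (S x) := sa_inner hSs _ _
    rw [this, inner_self_eq_norm_sq_to_K]; norm_cast
  have hup : ∀ x, ‖S x‖ ^ 2 ≤ ∑ n ∈ F, E n * ‖P n x‖ ^ 2 + 2 * c * ‖x‖ ^ 2 := fun x => by
    rw [hSn, hAin]
    have := (abs_le.1 (hZin x)).2
    linarith
  refine ⟨S, hSs, fun B hB => hSc B ?_, fun x => ?_, hup, fun R hR φ => ?_⟩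
  · exact hB.add_left ((Commute.one_left B).smul_left _)
  · rw [hSn, hAin]
    have := (abs_le.1 (hZin x)).1
    linarith
  have hAPF : ∀ x, PF P F x = x → PF P F (A x) = A x := fun x hx => by
    have h1 : PF P F (Dg P F E x) = Dg P F E x := by
      change (PF P F * Dg P F E) x = _
      rw [PF_mul_Dg hP]
    have h2 : PF P F (Z x) = Z x := by
      change (PF P F * Z) x = _
      rw [hZ.left]
    have : A x = Dg P F E x + Z x + (c : ℂ) • x := rfl
    rw [this, map_add, map_add, h1, h2, map_smul, hx]
  have hstep : ∀ a, 0 ≤ a → a + α ≤ s → ∀ x, PF P F x = x →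
      ‖Gm P F a (A x)‖ ≤ MA * ‖Gm P F (a + α) x‖ := by
    intro a ha has x hx
    have e : A x = Dg P F E x + Z x + (c : ℂ) • x := rfl
    have h1 := Gm_Dg hP F (a := a) hCE hE0 hE x
    have h2 : ‖Gm P F a (Z x)‖ ≤ CZ * (q * 2 ^ s) * K * ‖Gm P F (a + α) x‖ := by
      have e2 : Gm P F a (Z x) = (Gm P F a * Z * Gm P F (-(a + α))) (Gm P F (a + α) x) := by
        change _ = Gm P F a (Z ((Gm P F (-(a + α)) * Gm P F (a + α)) x))
        rw [Gm_neg_mul hP, hx]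
      rw [e2]
      refine ContinuousLinearMap.le_of_opNorm_le _ ?_ _
      refine hsch F _ (by positivity) _ ((hZ.diag hP _ _).mono fun m n => ?_)
      have hm := pn_pos m
      have hn := pn_pos n
      rw [abs_of_nonneg (by positivity), abs_of_nonneg (by positivity)]
      have h5 : ((m : ℕ) : ℝ) ^ a * ee p γ q m n * ((n : ℕ) : ℝ) ^ (-(a + α)) ≤
          q * (2 ^ s * jp m n ^ (-(p - q))) := by
        unfold ee
        rw [Finset.mul_sum, Finset.sum_mul]
        have := Finset.sum_le_card_nsmul (Finset.range q) _ _
          fun i hi => kerZ (p := p) hγ hγ2 (Finset.mem_range.1 hi) hα0 ha hs has hα m n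
        simpa using this
      calc _ = CZ * (((m : ℕ) : ℝ) ^ a * ee p γ q m n * ((n : ℕ) : ℝ) ^ (-(a + α))) := by ring
        _ ≤ CZ * (q * (2 ^ s * jp m n ^ (-(p - q)))) := by gcongr
        _ = _ := by ring
    have h3 : ‖Gm P F a ((c : ℂ) • x)‖ ≤ c * ‖Gm P F (a + α) x‖ := by
      rw [map_smul, norm_smul, Complex.norm_real, Real.norm_eq_abs, abs_of_nonneg hc0]
      have := Gm_mono hP F (a := a) (b := a + α) (by linarith) x
      gcongr
    rw [e, map_add, map_add]
    have := norm_add₃_le (a := Gm P F a (Dg P F E x)) (b := Gm P F a (Z x))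
      (c := Gm P F a ((c : ℂ) • x))
    rw [hMA]; linarith
  have hpow : ∀ i : ℕ, ∀ b, 0 ≤ b → b + i * α ≤ s → ∀ x, PF P F x = x →
      PF P F ((A ^ i) x) = (A ^ i) x ∧ ‖Gm P F b ((A ^ i) x)‖ ≤ MA ^ i * ‖Gm P F (b + i * α) x‖ := by
    intro i
    induction i with
    | zero => intro b hb _ x hx; simp [hx]
    | succ i ih =>
      intro b hb hbs x hx
      push_cast at hbs
      have h1 := ih b hb (by nlinarith) (A x) (hAPF x hx)
      have e : (A ^ (i + 1)) x = (A ^ i) (A x) := by rw [pow_succ]; rfl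
      rw [e]
      refine ⟨h1.1, h1.2.trans ?_⟩
      have h2 := hstep (b + i * α) (by positivity) (by linarith) x hx
      push_cast
      calc _ ≤ MA ^ i * (MA * ‖Gm P F (b + i * α + α) x‖) := by gcongr
        _ = _ := by rw [show b + (i + 1) * α = b + i * α + α by ring]; ring
  have hRs : ‖Gm P F s (R φ)‖ ≤ CR * K * ‖φ‖ := by
    have e : Gm P F s (R φ) = (Gm P F s * R * PF P F) φ := by
      rw [mul_assoc, hR.right]; rfl
    rw [e]
    refine ContinuousLinearMap.le_of_opNorm_le _ ?_ _
    refine hsch F _ hCR _ ((hR.diag hP _ _).mono fun m n => ?_)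
    have hm := pn_pos m
    rw [abs_of_nonneg (by positivity), abs_one, mul_one]
    have := kerR (p := p) (q := q) hγ m n
    rw [← hs] at this
    calc _ = CR * (((m : ℕ) : ℝ) ^ s * ww p γ q m n) := by ring
      _ ≤ _ := by gcongr
  have hRP : PF P F (R φ) = R φ := by
    change (PF P F * R) φ = _
    rw [hR.left]
  have hle1 : ∀ i ≤ j, MA ^ i ≤ (MA + 1) ^ j := fun i hi =>
    (pow_le_pow_left₀ hMA0 (by linarith) i).trans (pow_le_pow_right₀ (by linarith) hi)
  have hSA : ∀ i, S ^ (2 * i) = A ^ i := fun i => by rw [pow_mul, sq, hSS]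
  rcases Nat.even_or_odd' j with ⟨i, hi | hi⟩
  · have hji : (j : ℝ) = 2 * i := by exact_mod_cast hi
    have h1 := hpow i 0 le_rfl (by rw [hji] at hj; linarith) (R φ) hRP
    rw [Gm_zero, h1.1] at h1
    have h2 := Gm_mono hP F (a := 0 + i * α) (b := s) (by rw [hji] at hj; linarith) (R φ)
    rw [hi, hSA, ← hi]
    calc _ ≤ MA ^ i * ‖Gm P F (0 + i * α) (R φ)‖ := h1.2
      _ ≤ (MA + 1) ^ j * (CR * K * ‖φ‖) := by
        have := hle1 i (by omega); have := h2.trans hRs; gcongr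
      _ ≤ (CE + 2 * c + 1) * ((MA + 1) ^ j * (CR * K * ‖φ‖)) := by
        refine le_mul_of_one_le_left (by positivity) (by linarith)
      _ = _ := by ring
  · have hji : (j : ℝ) = 2 * i + 1 := by exact_mod_cast hi
    set y := (A ^ i) (R φ) with hy
    have h1 := hpow i (α / 2) (by linarith) (by rw [hji] at hj; nlinarith) (R φ) hRP
    have h2 := Gm_mono hP F (a := α / 2 + i * α) (b := s) (by rw [hji] at hj; nlinarith) (R φ)
    have h3 : ‖S y‖ ^ 2 ≤ (CE + 2 * c) * ‖Gm P F (α / 2) y‖ ^ 2 := by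
      refine (hup y).trans ?_
      have h4 : ∑ n ∈ F, E n * ‖P n y‖ ^ 2 ≤ CE * ‖Gm P F (α / 2) y‖ ^ 2 := by
        unfold Gm
        rw [norm_Dg_sq hP, Finset.mul_sum]
        refine Finset.sum_le_sum fun n _ => ?_
        rw [← Real.rpow_natCast (((n : ℕ) : ℝ) ^ (α / 2)), ← Real.rpow_mul (pn_pos n).le]
        have := hE n
        calc _ ≤ (CE * ((n : ℕ) : ℝ) ^ α) * ‖P n y‖ ^ 2 := by gcongr
          _ = _ := by rw [show α / 2 * ((2 : ℕ) : ℝ) = α by push_cast; ring]; ring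
      have h5 : ‖y‖ ≤ ‖Gm P F (α / 2) y‖ := by
        have := Gm_mono hP F (a := 0) (b := α / 2) (by linarith) y
        rwa [Gm_zero, h1.1] at this
      have h6 : 2 * c * ‖y‖ ^ 2 ≤ 2 * c * ‖Gm P F (α / 2) y‖ ^ 2 := by gcongr
      linarith
    have h7 : ‖S y‖ ≤ (CE + 2 * c + 1) * ‖Gm P F (α / 2) y‖ := by
      refine abs_le_of_sq_le_sq' ?_ (by positivity) |>.2
      rw [mul_pow]
      refine h3.trans ?_
      gcongr
      have : 0 ≤ CE + 2 * c := by positivity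
      nlinarith
    have e : (S ^ j) (R φ) = S y := by
      rw [hi, pow_succ', hSA]; rfl
    rw [e]
    calc _ ≤ (CE + 2 * c + 1) * ‖Gm P F (α / 2) y‖ := h7
      _ ≤ (CE + 2 * c + 1) * (MA ^ i * ‖Gm P F (α / 2 + i * α) (R φ)‖) := by
        have := h1.2; gcongr
      _ ≤ (CE + 2 * c + 1) * ((MA + 1) ^ j * (CR * K * ‖φ‖)) := by
        have := hle1 i (by omega); have := h2.trans hRs; gcongr
      _ = _ := by ring

end

noncomputable section
open ContinuousLinearMap
set_option linter.unusedSectionVars false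

variable {𝓗 : Type*} [NormedAddCommGroup 𝓗] [InnerProductSpace ℂ 𝓗] [CompleteSpace 𝓗]
variable {P : ℕ+ → 𝓗 →L[ℂ] 𝓗} {p γ T : ℝ}

lemma isom_of {Q : 𝓗 →L[ℂ] 𝓗} (h : star Q * Q = 1) (v : 𝓗) : ‖Q v‖ = ‖v‖ := by
  have h1 : inner ℂ (Q v) (Q v) = inner ℂ v v := by
    have := ContinuousLinearMap.adjoint_inner_left Q v (Q v)
    rw [← this, ← ContinuousLinearMap.star_eq_adjoint]
    change inner ℂ ((star Q * Q) v) v = _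
    rw [h]; rfl
  rw [inner_self_eq_norm_sq_to_K, inner_self_eq_norm_sq_to_K] at h1
  have h2 : ‖Q v‖ ^ 2 = ‖v‖ ^ 2 := by exact_mod_cast h1
  exact (sq_eq_sq₀ (norm_nonneg _) (norm_nonneg _)).1 h2

def Qp (G : 𝓗 →L[ℂ] 𝓗) (t : ℝ) : 𝓗 →L[ℂ] 𝓗 := NormedSpace.exp (t • (Complex.I • G))

lemma Qp_unitary {G : 𝓗 →L[ℂ] 𝓗} (hG : star G = G) (t : ℝ) :
    star (Qp G t) * Qp G t = 1 ∧ Qp G t * star (Qp G t) = 1 := by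
  have h : t • (Complex.I • G) ∈ skewAdjoint (𝓗 →L[ℂ] 𝓗) := by
    rw [skewAdjoint.mem_iff, star_smul, star_smul, hG]
    simp
  let +nondep : NormedAlgebra ℚ (𝓗 →L[ℂ] 𝓗) := .restrictScalars ℚ ℂ _
  have := NormedSpace.exp_mem_unitary_of_mem_skewAdjoint h
  exact this

lemma Qp_comm {G B : 𝓗 →L[ℂ] 𝓗} (h : Commute B G) (t : ℝ) : Commute B (Qp G t) :=
  ((h.smul_right Complex.I).smul_right t).exp_right

lemma Qp_deriv (G : 𝓗 →L[ℂ] 𝓗) (t : ℝ) :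
    HasDerivAt (Qp G) (Qp G t * (Complex.I • G)) t :=
  hasDerivAt_exp_smul_const (𝕂 := ℝ) (Complex.I • G) t

lemma duhamel {H0 Z S : 𝓗 →L[ℂ] 𝓗} {V X R : ℝ → 𝓗 →L[ℂ] 𝓗} {φ e : ℝ → 𝓗} {τ M CW D δ : ℝ} {j : ℕ}
    (hHs : star H0 = H0) (hZs : star Z = Z) (hτ : 0 < τ) (hM : 0 ≤ M) (hCW : 0 ≤ CW)
    (hX0 : X 0 = 0) (hXτ : X τ = 0) (hRc : Continuous R)
    (ode : ∀ t, HasDerivAt X (Complex.I • (V t - Z + (X t * H0 - H0 * X t) + X t * V t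
      - Z * X t - R t)) t)
    (hS : ∀ B, Commute (H0 + Z) B → Commute S B)
    (hR : ∀ t ∈ Set.Icc 0 τ, ∀ v, ‖(S ^ j) (R t v)‖ ≤ M * ‖v‖)
    (hW : ∀ t ∈ Set.Icc 0 τ, ‖1 + X t‖ ≤ CW)
    (hφ : ∀ t, HasDerivAt φ (-(Complex.I • (H0 (φ t) + V t (φ t) + e t))) t)
    (hec : Continuous e) (hφD : ∀ t ∈ Set.Icc 0 τ, ‖φ t‖ ≤ D) (heδ : ∀ t ∈ Set.Icc 0 τ, ‖e t‖ ≤ δ) :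
    ∃ y1 y2, Qp (H0 + Z) τ (φ τ) = φ 0 + y1 + y2 ∧ ‖(S ^ j) y1‖ ≤ M * D * τ ∧
      ‖y2‖ ≤ CW * δ * τ := by
  set G := H0 + Z with hG
  have hGs : star G = G := by rw [hG, star_add, hHs, hZs]
  have hφc : Continuous φ := continuous_iff_continuousAt.2 fun t => (hφ t).continuousAt
  have hXc : Continuous X := continuous_iff_continuousAt.2 fun t => (ode t).continuousAt
  have hQc : Continuous (Qp G) := continuous_iff_continuousAt.2 fun t => (Qp_deriv G t).continuousAt
  set g1 : ℝ → 𝓗 := fun t => -(Complex.I • Qp G t (R t (φ t))) with hg1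
  set g2 : ℝ → 𝓗 := fun t => -(Complex.I • Qp G t ((1 + X t) (e t))) with hg2
  have hg1c : Continuous g1 := (((hQc.clm_apply (hRc.clm_apply hφc)).const_smul Complex.I)).neg
  have hg2c : Continuous g2 :=
    (((hQc.clm_apply ((continuous_const.add hXc).clm_apply hec)).const_smul Complex.I)).neg
  have hf : ∀ t, HasDerivAt (fun t => Qp G t ((1 + X t) (φ t))) (g1 t + g2 t) t := by
    intro t
    have h1 : HasDerivAt (fun t => 1 + X t) _ t := (ode t).const_add 1
    have hW' : HasDerivAt (fun t => Qp G t * (1 + X t)) _ t := (Qp_deriv G t).mul h1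
    let ev : (𝓗 →L[ℂ] 𝓗) →L[ℝ] 𝓗 →L[ℝ] 𝓗 := ContinuousLinearMap.restrictScalarsL ℂ 𝓗 𝓗 ℝ ℝ
    have h2 : HasDerivAt (fun t => ev (Qp G t * (1 + X t))) _ t := ev.hasFDerivAt.comp_hasDerivAt t hW'
    have h3 := h2.clm_apply (hφ t)
    refine h3.congr_deriv ?_
    simp only [ev, hg1, hg2]
    change (Qp G t * (Complex.I • G) * (1 + X t) + Qp G t * (Complex.I • (V t - Z + (X t * H0 - H0 * X t) + X t * V t
      - Z * X t - R t))) (φ t) + (Qp G t * (1 + X t)) (-(Complex.I • (H0 (φ t) + V t (φ t) + e t))) = _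
    have e1 : (Qp G t * (Complex.I • G) * (1 + X t) + Qp G t * (Complex.I • (V t - Z + (X t * H0 - H0 * X t) + X t * V t
      - Z * X t - R t))) = Complex.I • (Qp G t * ((1 + X t) * (H0 + V t) - R t)) := by
      simp only [mul_smul_comm, smul_mul_assoc, ← smul_add]
      congr 1
      rw [mul_assoc, ← mul_add]
      congr 1
      rw [hG]
      noncomm_ring
    rw [e1]
    change Complex.I • (Qp G t ((1 + X t) (H0 (φ t) + V t (φ t)) - R t (φ t))) +
      Qp G t ((1 + X t) (-(Complex.I • (H0 (φ t) + V t (φ t) + e t)))) = _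
    simp only [map_neg, map_smul, map_add, map_sub, smul_add, smul_sub, neg_add]
    abel
  have hintg := intervalIntegral.integral_eq_sub_of_hasDerivAt (a := 0) (b := τ)
      (fun t _ => hf t) ((hg1c.add hg2c).intervalIntegrable _ _)
  rw [intervalIntegral.integral_add (hg1c.intervalIntegrable _ _) (hg2c.intervalIntegrable _ _)] at hintg
  have hQ0 : Qp G 0 = 1 := by simp [Qp]
  rw [hX0, hXτ, hQ0] at hintg
  simp only [add_zero] at hintg
  replace hintg : (∫ x in (0:ℝ)..τ, g1 x) + ∫ x in (0:ℝ)..τ, g2 x = (Qp G τ) (φ τ) - φ 0 := hintg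
  have hsub : ∀ t ∈ Set.uIoc 0 τ, t ∈ Set.Icc 0 τ := fun t ht => by
    rw [Set.uIoc_of_le hτ.le] at ht; exact ⟨ht.1.le, ht.2⟩
  refine ⟨∫ t in (0:ℝ)..τ, g1 t, ∫ t in (0:ℝ)..τ, g2 t, ?_, ?_, ?_⟩
  · rw [add_assoc, hintg]; abel
  · rw [← ContinuousLinearMap.intervalIntegral_comp_comm _ (hg1c.intervalIntegrable _ _)]
    have := intervalIntegral.norm_integral_le_of_norm_le_const (a := 0) (b := τ) (C := M * D)
      (f := fun t => (S ^ j) (g1 t)) fun t ht => by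
        have hc : Commute (S ^ j) (Qp G t) := (hS _ (Qp_comm (Commute.refl G) t)).pow_left j
        simp only [hg1, map_neg, map_smul, norm_neg, norm_smul, Complex.norm_I, one_mul]
        have e1 : (S ^ j) (Qp G t (R t (φ t))) = Qp G t ((S ^ j) (R t (φ t))) :=
          congrArg (fun B : 𝓗 →L[ℂ] 𝓗 => B (R t (φ t))) hc.eq
        rw [e1, isom_of (Qp_unitary hGs t).1]
        refine (hR t (hsub t ht) _).trans ?_
        have := hφD t (hsub t ht)
        gcongr
    rwa [sub_zero, abs_of_pos hτ] at this
  · have := intervalIntegral.norm_integral_le_of_norm_le_const (a := 0) (b := τ) (C := CW * δ)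
      (f := g2) fun t ht => by
        simp only [hg2, norm_neg, norm_smul, Complex.norm_I, one_mul]
        rw [isom_of (Qp_unitary hGs t).1]
        refine (ContinuousLinearMap.le_of_opNorm_le _ (hW t (hsub t ht)) _).trans ?_
        have := heδ t (hsub t ht)
        gcongr
    rwa [sub_zero, abs_of_pos hτ] at this

lemma nstep {Q S : 𝓗 →L[ℂ] 𝓗} (hQ : star Q * Q = 1) (hc : Commute S Q) {j : ℕ} {B1 B2 : ℝ}
    (u : ℕ → 𝓗) (n : ℕ) (h : ∀ k < n, ∃ y1 y2, Q (u (k + 1)) = u k + y1 + y2 ∧ ‖(S ^ j) y1‖ ≤ B1 ∧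
      ‖y2‖ ≤ B2) :
    ∃ y1 y2, (Q ^ n) (u n) = u 0 + y1 + y2 ∧ ‖(S ^ j) y1‖ ≤ n * B1 ∧ ‖y2‖ ≤ n * B2 := by
  induction n with
  | zero => exact ⟨0, 0, by simp, by simp, by simp⟩
  | succ n ih =>
    obtain ⟨Y1, Y2, h1, h2, h3⟩ := ih fun k hk => h k (by omega)
    obtain ⟨y1, y2, g1, g2, g3⟩ := h n (by omega)
    have hQn : ∀ m : ℕ, ∀ v, ‖(Q ^ m) v‖ = ‖v‖ := fun m => by
      induction m with
      | zero => intro v; simp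
      | succ m ihm =>
        intro v
        rw [pow_succ]
        change ‖(Q ^ m) (Q v)‖ = _
        rw [ihm, isom_of hQ]
    refine ⟨Y1 + (Q ^ n) y1, Y2 + (Q ^ n) y2, ?_, ?_, ?_⟩
    · rw [pow_succ]
      change (Q ^ n) (Q _) = _
      rw [g1, map_add, map_add, h1]; abel
    · have e1 : (S ^ j) ((Q ^ n) y1) = (Q ^ n) ((S ^ j) y1) :=
        congrArg (fun B : 𝓗 →L[ℂ] 𝓗 => B y1) (hc.pow_pow j n).eq
      rw [map_add, e1]
      refine (norm_add_le _ _).trans ?_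
      rw [hQn, Nat.cast_succ]; linarith
    · refine (norm_add_le _ _).trans ?_
      rw [hQn, Nat.cast_succ]; linarith

end

noncomputable section
open ContinuousLinearMap
set_option linter.unusedSectionVars false

variable {𝓗 : Type*} [NormedAddCommGroup 𝓗] [InnerProductSpace ℂ 𝓗] [CompleteSpace 𝓗]
variable {P : ℕ+ → 𝓗 →L[ℂ] 𝓗} {p γ T : ℝ}

lemma run_arith {CW c L Eu D w2 a b y u z0 : ℝ} (hCW : 0 ≤ CW) (hc : 0 ≤ c) (hL : 0 ≤ L)
    (hEu : 0 ≤ Eu) (hw : 0 ≤ w2) (ha : 0 ≤ a) (hu : 0 ≤ u) (huD : u ≤ D)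
    (hz0 : z0 ≤ a ^ 2) (hab : a ≤ b + y) (hb2 : b ^ 2 ≤ Eu + 2 * c * u ^ 2)
    (hy2 : y ^ 2 ≤ L * w2) :
    z0 ≤ (CW + 2 + 4 * c + 2 * L) * (Eu + D ^ 2 + w2) := by
  have b3 : a ^ 2 ≤ 2 * b ^ 2 + 2 * y ^ 2 := by
    have : a ^ 2 ≤ (b + y) ^ 2 := by gcongr
    nlinarith [sq_nonneg (b - y)]
  have b5 : 2 * c * u ^ 2 ≤ 2 * c * D ^ 2 := by gcongr
  have c1 : 2 * Eu ≤ (CW + 2 + 4 * c + 2 * L) * Eu := by gcongr; linarith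
  have c2 : 4 * c * D ^ 2 ≤ (CW + 2 + 4 * c + 2 * L) * D ^ 2 := by gcongr; linarith
  have c3 : 2 * L * w2 ≤ (CW + 2 + 4 * c + 2 * L) * w2 := by gcongr; linarith
  linarith

lemma run_arith2 {y D CW d : ℝ} (h : y ≤ 2 * D + CW * d) (hC : 0 ≤ CW) (hD : 0 ≤ D) (hd : 0 ≤ d) :
    y ≤ (2 + CW) * (D + d) := by
  have := mul_nonneg hC hD
  nlinarith

set_option maxHeartbeats 1600000 in
lemma run (hP : ProjFamily P) (hγ : 0 < γ) (hγ2 : 2 * γ ≤ 1) {q : ℕ} (hq : 1 < p - (q : ℝ))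
    {E : ℕ+ → ℝ} {CE α s CH : ℝ} (hα : α = 1 - 2 * γ) (hCE : 0 ≤ CE)
    (hs : s = 2 * ((q : ℝ) + 1) * γ)
    (hE0 : ∀ n, 0 < E n) (hE : ∀ n, E n ≤ CE * ((n : ℕ) : ℝ) ^ α) (hCH : 0 ≤ CH)
    (hEH : ∀ m n, |E m - E n| ≤ CH * jp m n * mx m n ^ (-(2 * γ)))
    {j : ℕ} (hj1 : 1 ≤ j) (hj : (j : ℝ) * α / 2 ≤ s) :
    ∃ C : ℝ, 0 ≤ C ∧ ∀ x : Sc P p γ T, ∀ n : ℕ, 1 ≤ n →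
      (∀ k < n, ∀ t, x.V (t + k * x.τ) = x.V t) → ∀ (φ e : ℝ → 𝓗) (D δ : ℝ),
      (∀ t, HasDerivAt φ (-(Complex.I • (Dg P x.F E (φ t) + x.V t (φ t) + e t))) t) →
      Continuous e → (∀ t ∈ Set.Icc 0 (n * x.τ), ‖φ t‖ ≤ D) → (∀ t ∈ Set.Icc 0 (n * x.τ), ‖e t‖ ≤ δ) →
      (∃ z z', φ (n * x.τ) = z + z' ∧ ‖z'‖ ≤ C * (δ * (n * x.τ)) ∧ ∑ m ∈ x.F, E m * ‖P m z‖ ^ 2 ≤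
        C * (∑ m ∈ x.F, E m * ‖P m (φ 0)‖ ^ 2 + D ^ 2 +
          (n * x.τ) ^ ((2 : ℝ) / j) * (D + δ * (n * x.τ)) ^ 2)) ∧
      (∃ z z', φ 0 = z + z' ∧ ‖z'‖ ≤ C * (δ * (n * x.τ)) ∧ ∑ m ∈ x.F, E m * ‖P m z‖ ^ 2 ≤
        C * (∑ m ∈ x.F, E m * ‖P m (φ (n * x.τ))‖ ^ 2 + D ^ 2 +
          (n * x.τ) ^ ((2 : ℝ) / j) * (D + δ * (n * x.τ)) ^ 2)) := by
  obtain ⟨X, R, Z, hI⟩ := ind_all (P := P) (T := T) hP hγ hγ2 hCH hEH hq q le_rfl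
  obtain ⟨CZ, hCZ, hZ⟩ := hI.Zo
  obtain ⟨CR, hCR, hR⟩ := hI.Ro
  obtain ⟨CX, hCX, hX⟩ := hI.Xo
  obtain ⟨K, hK, hsch⟩ := schur_jp (𝓗 := 𝓗) hP hq
  obtain ⟨c, M, hc, hM, hops⟩ := core_ops hP hγ hγ2 hq hα hCE hs hE0 hE hCZ hCR hj
  set CW := 1 + CX * q * K with hCW
  have hCW0 : 0 ≤ CW := by positivity
  refine ⟨CW + 2 + 4 * c + 2 * ((2 + CW) ^ 2 + M ^ 2), by positivity, ?_⟩
  intro x n hn hper φ e D δ hφ hec hφD heδ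
  have hτ := x.hτ
  have h0mem : (0 : ℝ) ∈ Set.Icc 0 x.τ := ⟨le_rfl, hτ.le⟩
  obtain ⟨S, hSs, hSc, hSlo, hSup, hSR⟩ := hops x.F (Z x) (hI.Zs x) (hZ x 0 h0mem)
  have hW : ∀ t ∈ Set.Icc 0 x.τ, ‖1 + X x t‖ ≤ CW := fun t ht => by
    have h1 : ‖X x t‖ ≤ CX * q * K := by
      refine hsch x.F (CX * q) (by positivity) _ ((hX x t ht).mono fun m n => ?_)
      have : ee p γ q m n ≤ q * jp m n ^ (-(p - q)) := by
        unfold ee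
        have := Finset.sum_le_card_nsmul (Finset.range q) (fun i => ww p γ i m n)
          (jp m n ^ (-(p - q))) fun i hi => ww_le hγ (Finset.mem_range.1 hi).le m n
        simpa using this
      rw [mul_assoc]
      gcongr
    have h2 : ‖(1 : 𝓗 →L[ℂ] 𝓗)‖ ≤ 1 := ContinuousLinearMap.norm_id_le
    exact (norm_add_le _ _).trans (add_le_add h2 h1)
  set t := (n : ℝ) * x.τ with ht
  have hn' : (1 : ℝ) ≤ n := by exact_mod_cast hn
  have ht0 : 0 < t := by positivity
  have hD0 : 0 ≤ D := (norm_nonneg _).trans (hφD 0 ⟨le_rfl, ht0.le⟩)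
  have hδ0 : 0 ≤ δ := (norm_nonneg _).trans (heδ 0 ⟨le_rfl, ht0.le⟩)
  set G := Dg P x.F E + Z x with hG
  have hGs : star G = G := by rw [hG, star_add, Dg_star hP, hI.Zs]
  have hsteps : ∀ k < n, ∃ y1 y2, Qp G x.τ (φ ((k + 1 : ℕ) * x.τ)) = φ ((k : ℕ) * x.τ) + y1 + y2 ∧
      ‖(S ^ j) y1‖ ≤ M * D * x.τ ∧ ‖y2‖ ≤ CW * δ * x.τ := by
    intro k hk
    have hk' : ((k : ℝ) + 1) ≤ n := by exact_mod_cast hk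
    have hin : ∀ r ∈ Set.Icc 0 x.τ, r + k * x.τ ∈ Set.Icc 0 t := fun r hr => by
      have h1 := hr.1
      refine ⟨by positivity, ?_⟩
      calc r + k * x.τ ≤ x.τ + k * x.τ := by linarith [hr.2]
        _ = (k + 1) * x.τ := by ring
        _ ≤ t := by rw [ht]; gcongr
    have := duhamel (φ := fun r => φ (r + k * x.τ)) (e := fun r => e (r + k * x.τ))
      (Dg_star hP x.F E) (hI.Zs x) hτ hM hCW0 (hI.X0 x) (hI.Xτ x) (hI.Rc x) (hI.ode x) hSc
      (fun r hr => hSR _ (hR x r hr)) hW (D := D) (δ := δ)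
      (fun r => by
        have h1 := (hφ (r + k * x.τ)).comp_add_const r (k * x.τ)
        rwa [hper k hk] at h1)
      (hec.comp (continuous_id.add continuous_const)) (fun r hr => hφD _ (hin r hr))
      (fun r hr => heδ _ (hin r hr))
    obtain ⟨y1, y2, h1, h2, h3⟩ := this
    refine ⟨y1, y2, ?_, h2, h3⟩
    simp only [zero_add] at h1
    rw [show ((k + 1 : ℕ) : ℝ) * x.τ = x.τ + k * x.τ by push_cast; ring]
    exact h1
  have hQu := Qp_unitary hGs x.τ
  have hSQ : Commute S (Qp G x.τ) := hSc _ (Qp_comm (Commute.refl G) x.τ)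
  obtain ⟨Y, Y2, h1, h2, h3⟩ := nstep hQu.1 hSQ (fun k : ℕ => φ (k * x.τ)) n hsteps
  simp only [Nat.cast_zero, zero_mul] at h1
  rw [← ht] at h1
  set Qn := Qp G x.τ ^ n with hQn
  have hQn1 : star Qn * Qn = 1 ∧ Qn * star Qn = 1 := by
    have hu : Qp G x.τ ∈ unitary (𝓗 →L[ℂ] 𝓗) := hQu
    exact pow_mem hu n
  have hSQn : Commute S Qn := hSQ.pow_right n
  have hSQs : Commute S (star Qn) := by
    have := congrArg star hSQn.eq
    rw [star_mul, star_mul, hSs] at this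
    exact this.symm
  have hiso : ∀ v, ‖Qn v‖ = ‖v‖ := isom_of hQn1.1
  have hisos : ∀ v, ‖star Qn v‖ = ‖v‖ := isom_of (by rw [star_star]; exact hQn1.2)
  have hinv : ∀ v, star Qn (Qn v) = v := fun v => by
    change (star Qn * Qn) v = v
    rw [hQn1.1]; rfl
  have h2' : ‖(S ^ j) Y‖ ≤ M * D * t := by
    refine h2.trans (le_of_eq ?_); rw [ht]; ring
  have h3' : ‖Y2‖ ≤ CW * (δ * t) := by
    refine h3.trans (le_of_eq ?_); rw [ht]; ring
  have hu0 : ‖φ 0‖ ≤ D := hφD 0 ⟨le_rfl, ht0.le⟩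
  have hun : ‖φ t‖ ≤ D := hφD t ⟨ht0.le, le_rfl⟩
  have hYn : ‖Y‖ ≤ 2 * D + CW * (δ * t) := by
    have e : Y = Qn (φ t) - φ 0 - Y2 := by rw [h1]; abel
    rw [e]
    refine (norm_sub_le _ _).trans ?_
    have := norm_sub_le (Qn (φ t)) (φ 0)
    rw [hiso] at this
    linarith
  have hSY := interp_t hSs ht0 (by positivity) hj1 h2'
  have hδt : 0 ≤ δ * t := by positivity
  set w := t ^ ((2 : ℝ) / j) with hw
  have hw0 : 0 ≤ w := by positivity
  have hSY' : ‖S Y‖ ^ 2 ≤ w * (((2 + CW) ^ 2 + M ^ 2) * (D + δ * t) ^ 2) := by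
    refine hSY.trans ?_
    gcongr
    have a1 : ‖Y‖ ≤ (2 + CW) * (D + δ * t) := run_arith2 hYn hCW0 hD0 hδt
    have a2 : M * D ≤ M * (D + δ * t) := by gcongr; linarith
    calc _ ≤ ((2 + CW) * (D + δ * t)) ^ 2 + (M * (D + δ * t)) ^ 2 := by gcongr
      _ = _ := by ring
  have hfin : ∀ u v z : 𝓗, ‖u‖ ≤ D → ‖S z‖ ≤ ‖S u‖ + ‖S Y‖ →
      ∑ m ∈ x.F, E m * ‖P m z‖ ^ 2 ≤ (CW + 2 + 4 * c + 2 * ((2 + CW) ^ 2 + M ^ 2)) *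
        (∑ m ∈ x.F, E m * ‖P m u‖ ^ 2 + D ^ 2 + w * (D + δ * t) ^ 2) := by
    intro u v z hu hz
    have b1 := hSlo z
    have b2 := hSup u
    have b4 : 0 ≤ ∑ m ∈ x.F, E m * ‖P m u‖ ^ 2 :=
      Finset.sum_nonneg fun n _ => by have := hE0 n; positivity
    exact run_arith hCW0 hc (by positivity) b4 (by positivity) (norm_nonneg _) (norm_nonneg _) hu b1 hz b2
      (by linarith)
  have hCC : CW * (δ * t) ≤ (CW + 2 + 4 * c + 2 * ((2 + CW) ^ 2 + M ^ 2)) * (δ * t) := by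
    gcongr
    have : 0 ≤ (2 + CW) ^ 2 + M ^ 2 := by positivity
    linarith
  refine ⟨⟨star Qn (φ 0 + Y), star Qn Y2, ?_, ?_, ?_⟩, ⟨Qn (φ t) - Y, -Y2, ?_, ?_, ?_⟩⟩
  · rw [← map_add, ← h1, hinv]
  · rw [hisos]; exact h3'.trans hCC
  · refine hfin (φ 0) 0 _ hu0 ?_
    have e1 : S (star Qn (φ 0 + Y)) = star Qn (S (φ 0 + Y)) :=
      congrArg (fun B : 𝓗 →L[ℂ] 𝓗 => B (φ 0 + Y)) hSQs.eq
    rw [e1, hisos, map_add]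
    exact norm_add_le _ _
  · rw [h1]; abel
  · rw [norm_neg]; exact h3'.trans hCC
  · refine hfin (φ t) 0 _ hun ?_
    have e1 : S (Qn (φ t)) = Qn (S (φ t)) :=
      congrArg (fun B : 𝓗 →L[ℂ] 𝓗 => B (φ t)) hSQn.eq
    rw [map_sub, e1]
    refine (norm_sub_le _ _).trans ?_
    rw [hiso]

end

noncomputable section
open ContinuousLinearMap
set_option linter.unusedSectionVars false

variable {𝓗 : Type*} [NormedAddCommGroup 𝓗] [InnerProductSpace ℂ 𝓗] [CompleteSpace 𝓗]
variable {P : ℕ+ → 𝓗 →L[ℂ] 𝓗} {p γ T : ℝ} {E : ℕ+ → ℝ}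

/-- The conclusion of `run`. -/
def RunC (P : ℕ+ → 𝓗 →L[ℂ] 𝓗) (p γ T : ℝ) (E : ℕ+ → ℝ) (j : ℕ) (C : ℝ) : Prop :=
  ∀ x : Sc P p γ T, ∀ n : ℕ, 1 ≤ n →
      (∀ k < n, ∀ t, x.V (t + k * x.τ) = x.V t) → ∀ (φ e : ℝ → 𝓗) (D δ : ℝ),
      (∀ t, HasDerivAt φ (-(Complex.I • (Dg P x.F E (φ t) + x.V t (φ t) + e t))) t) →
      Continuous e → (∀ t ∈ Set.Icc 0 (n * x.τ), ‖φ t‖ ≤ D) → (∀ t ∈ Set.Icc 0 (n * x.τ), ‖e t‖ ≤ δ) →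
      (∃ z z', φ (n * x.τ) = z + z' ∧ ‖z'‖ ≤ C * (δ * (n * x.τ)) ∧ ∑ m ∈ x.F, E m * ‖P m z‖ ^ 2 ≤
        C * (∑ m ∈ x.F, E m * ‖P m (φ 0)‖ ^ 2 + D ^ 2 +
          (n * x.τ) ^ ((2 : ℝ) / j) * (D + δ * (n * x.τ)) ^ 2)) ∧
      (∃ z z', φ 0 = z + z' ∧ ‖z'‖ ≤ C * (δ * (n * x.τ)) ∧ ∑ m ∈ x.F, E m * ‖P m z‖ ^ 2 ≤
        C * (∑ m ∈ x.F, E m * ‖P m (φ (n * x.τ))‖ ^ 2 + D ^ 2 +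
          (n * x.τ) ^ ((2 : ℝ) / j) * (D + δ * (n * x.τ)) ^ 2))

/-- All partial energies are bounded by `S`. -/
def EB (P : ℕ+ → 𝓗 →L[ℂ] 𝓗) (E : ℕ+ → ℝ) (x : 𝓗) (S : ℝ) : Prop :=
  ∀ F : Finset ℕ+, ∑ m ∈ F, E m * ‖P m x‖ ^ 2 ≤ S

lemma EB.nonneg {x : 𝓗} {S : ℝ} (h : EB P E x S) : 0 ≤ S := by simpa using h ∅

lemma cont_of_strongC1 {V : ℝ → 𝓗 →L[ℂ] 𝓗} (hV : StrongC1 V) : Continuous V := by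
  rw [continuous_iff_continuousAt]
  intro t0
  have hb : ∃ C', ∀ i : Set.Icc (t0 - 1) (t0 + 1),
      ‖(((i : ℝ) - t0)⁻¹ : ℂ) • (V i - V t0)‖ ≤ C' := by
    apply banach_steinhaus
    intro x
    have hd : Continuous (deriv fun t => V t x) := (hV x).continuous_deriv le_rfl
    obtain ⟨K, hK⟩ := isCompact_Icc.exists_bound_of_continuousOn (s := Set.Icc (t0 - 1) (t0 + 1))
      hd.continuousOn
    refine ⟨K, fun i => ?_⟩
    have h1 := (convex_Icc (t0 - 1) (t0 + 1)).norm_image_sub_le_of_norm_deriv_le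
      (f := fun t => V t x) (fun y _ => ((hV x).differentiable one_ne_zero) y) hK
      (x := t0) (y := i) ⟨by linarith, by linarith⟩ i.2
    change ‖(((i : ℝ) - t0)⁻¹ : ℂ) • (V i x - V t0 x)‖ ≤ K
    rw [norm_smul, norm_inv]
    have e : ‖((i : ℝ) : ℂ) - (t0 : ℂ)‖ = ‖(i : ℝ) - t0‖ := by
      rw [← Complex.ofReal_sub, Complex.norm_real]
    rw [e]
    have hK0 : 0 ≤ K := (norm_nonneg _).trans (hK t0 ⟨by linarith, by linarith⟩)
    rcases eq_or_lt_of_le (norm_nonneg ((i : ℝ) - t0)) with h | h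
    · rw [← h]; simpa using hK0
    · rw [inv_mul_le_iff₀ h]; linarith
  obtain ⟨C', hC'⟩ := hb
  have hC0 : 0 ≤ C' := (norm_nonneg _).trans (hC' ⟨t0, by linarith, by linarith⟩)
  have key : ∀ᶠ t in nhds t0, ‖V t - V t0‖ ≤ C' * ‖t - t0‖ := by
    filter_upwards [Icc_mem_nhds (show t0 - 1 < t0 by linarith) (show t0 < t0 + 1 by linarith)]
      with t ht
    by_cases h : t = t0
    · subst h; simp
    have h2 := hC' ⟨t, ht⟩
    have e : ‖(t : ℂ) - (t0 : ℂ)‖ = ‖t - t0‖ := by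
      rw [← Complex.ofReal_sub, Complex.norm_real]
    rw [norm_smul, norm_inv] at h2
    simp only [e] at h2
    rwa [inv_mul_le_iff₀ (norm_pos_iff.2 (sub_ne_zero.2 h)), mul_comm] at h2
  rw [ContinuousAt, tendsto_iff_norm_sub_tendsto_zero]
  refine squeeze_zero' (Filter.Eventually.of_forall fun _ => norm_nonneg _) key ?_
  have : Continuous fun t : ℝ => C' * ‖t - t0‖ := by fun_prop
  simpa using this.tendsto t0

lemma Dg_apply (F : Finset ℕ+) (f : ℕ+ → ℝ) (x : 𝓗) :
    Dg P F f x = ∑ n ∈ F, (f n : ℂ) • P n x := by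
  unfold Dg; rw [sum_apply]; rfl

lemma PF_apply (F : Finset ℕ+) (x : 𝓗) : PF P F x = ∑ n ∈ F, P n x := by
  unfold PF; rw [Dg_apply]; simp

lemma exists_HSum (hP : ProjFamily P) {x : 𝓗} (hx : x ∈ HDom P E) : ∃ h, IsHSum P E x h := by
  suffices Summable fun n => (E n : ℂ) • P n x from ⟨_, this.hasSum⟩
  have hx' : Summable fun n => (E n) ^ 2 * ‖P n x‖ ^ 2 := hx
  rw [summable_iff_vanishing_norm] at hx' ⊢
  intro ε hε
  obtain ⟨s, hs⟩ := hx' (ε ^ 2) (by positivity)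
  refine ⟨s, fun t ht => ?_⟩
  have h := hs t ht
  rw [← norm_Dg_sq hP, ] at h
  rw [← Dg_apply]
  rw [Real.norm_of_nonneg (by positivity)] at h
  exact lt_of_pow_lt_pow_left₀ 2 hε.le h

lemma PF_HSum (hP : ProjFamily P) {x h : 𝓗} (hx : IsHSum P E x h) (F : Finset ℕ+) :
    PF P F h = Dg P F E x := by
  rw [PF_apply, Dg_apply]
  refine Finset.sum_congr rfl fun m _ => ?_
  have h1 := (show HasSum _ _ from hx).mapL (P m)
  refine h1.unique ?_
  have h2 : P m ((E m : ℂ) • P m x) = (E m : ℂ) • P m x := by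
    rw [map_smul]; congr 1
    change (P m * P m) x = _
    rw [PP hP]
  have h3 := hasSum_single (f := fun n => P m ((E n : ℂ) • P n x)) m (fun n hn => by
    rw [map_smul]
    change (E n : ℂ) • ((P m * P n) x) = 0
    rw [PPne hP hn.symm]; simp)
  rw [h2] at h3
  exact h3

lemma P_PF (hP : ProjFamily P) {F : Finset ℕ+} {m : ℕ+} (hm : m ∈ F) (x : 𝓗) :
    P m (PF P F x) = P m x := by
  change (P m * PF P F) x = _
  rw [PF, P_mul_Dg_mem hP F hm]; simp

lemma P_PF_le (hP : ProjFamily P) (F : Finset ℕ+) (m : ℕ+) (x : 𝓗) :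
    ‖P m (PF P F x)‖ ≤ ‖P m x‖ := by
  by_cases hm : m ∈ F
  · rw [P_PF hP hm]
  · change ‖(P m * PF P F) x‖ ≤ _
    rw [PF, P_mul_Dg_nmem hP F hm]; simp

lemma PF_tendsto (hP : ProjFamily P) (x : 𝓗) :
    Filter.Tendsto (fun F => PF P F x) Filter.atTop (nhds x) := by
  have := hP.2.2.2.2 x
  simp only [PF_apply]
  exact this

lemma PF_contr (hP : ProjFamily P) (F : Finset ℕ+) (x : 𝓗) : ‖PF P F x‖ ≤ ‖x‖ := by
  have := (PF P F).le_of_opNorm_le (norm_PF_le hP F) x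
  rwa [one_mul] at this

lemma PF_unif (hP : ProjFamily P) {K : Set 𝓗} (hK : IsCompact K) {η : ℝ} (hη : 0 < η) :
    ∀ᶠ F in Filter.atTop, ∀ x ∈ K, ‖x - PF P F x‖ ≤ η := by
  obtain ⟨t, htK, htf, htc⟩ := hK.finite_cover_balls (show 0 < η / 3 by linarith)
  have h1 : ∀ᶠ F in Filter.atTop, ∀ y ∈ t, ‖y - PF P F y‖ < η / 3 := by
    rw [Filter.eventually_all_finite htf]
    intro y _
    have := (PF_tendsto hP y).eventually (Metric.ball_mem_nhds y (show 0 < η / 3 by linarith))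
    filter_upwards [this] with F hF
    rw [dist_eq_norm] at hF
    rwa [norm_sub_rev]
  filter_upwards [h1] with F hF x hx
  obtain ⟨y, hy, hxy⟩ := Set.mem_iUnion₂.1 (htc hx)
  rw [Metric.mem_ball, dist_eq_norm] at hxy
  have e : x - PF P F x = (x - y) + (y - PF P F y) - PF P F (x - y) := by rw [map_sub]; abel
  rw [e]
  have a1 := norm_sub_le ((x - y) + (y - PF P F y)) (PF P F (x - y))
  have a2 := norm_add_le (x - y) (y - PF P F y)
  have a3 := PF_contr hP F (x - y)
  have a4 := hF y hy
  linarith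

lemma trunc_bd (hP : ProjFamily P) {W : 𝓗 →L[ℂ] 𝓗} (hW : ∀ m n, wnorm P p γ W m n ≤ 1)
    (F : Finset ℕ+) : Bd P F (ww p γ 0) (PF P F * W * PF P F) := by
  have h3 : PF P F * PF P F = PF P F := PF_mul_Dg hP F _
  refine ⟨by rw [← mul_assoc, ← mul_assoc, h3], by rw [mul_assoc, h3], fun m n => ?_⟩
  have h0 : ‖P m * W * P n‖ ≤ ww p γ 0 m n := by
    have := hW m n
    unfold wnorm at this
    change jp m n ^ p * mx m n ^ (2 * γ) * ‖P m * (W * P n)‖ ≤ 1 at this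
    rw [← mul_assoc (P m)] at this
    have a1 : 0 < jp m n ^ p := Real.rpow_pos_of_pos (jp_pos m n) _
    have a2 : 0 < mx m n ^ (2 * γ) := Real.rpow_pos_of_pos (mx_pos m n) _
    have e : ww p γ 0 m n = (jp m n ^ p * mx m n ^ (2 * γ))⁻¹ := by
      unfold ww wt
      rw [Nat.cast_zero, sub_zero, zero_add, mul_one, Real.rpow_neg (jp_pos m n).le,
        Real.rpow_neg (mx_pos m n).le, mul_inv]
    rw [e, ← one_div, le_div_iff₀ (by positivity)]
    linarith
  have h1 : P m * (PF P F * W * PF P F) * P n = (P m * PF P F) * W * (PF P F * P n) := by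
    simp only [mul_assoc]
  rw [h1]
  by_cases hm : m ∈ F
  · by_cases hn : n ∈ F
    · rw [PF, P_mul_Dg_mem hP F hm, Dg_mul_P_mem hP F hn]; simpa using h0
    · rw [PF, Dg_mul_P_nmem hP F hn]; simpa using ww_nonneg p γ 0 m n
  · rw [PF, P_mul_Dg_nmem hP F hm]; simpa using ww_nonneg p γ 0 m n

lemma lim_step {C t S N w : ℝ} {y : 𝓗} {L : Finset ℕ+}
    (h : ∀ η > 0, ∃ z : 𝓗, ‖z‖ ≤ C * (η * t) ∧ ∑ m ∈ L, E m * ‖P m (y - z)‖ ^ 2 ≤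
      C * (S + N ^ 2 + w * (N + η * t) ^ 2)) :
    ∑ m ∈ L, E m * ‖P m y‖ ^ 2 ≤ C * (S + N ^ 2 + w * N ^ 2) := by
  have hη := tendsto_one_div_add_atTop_nhds_zero_nat (𝕜 := ℝ)
  choose z hz hz2 using fun k : ℕ => h (1 / ((k : ℝ) + 1)) (by positivity)
  have hz0 : Filter.Tendsto z Filter.atTop (nhds 0) := by
    refine squeeze_zero_norm hz ?_
    simpa using ((hη.mul_const t).const_mul C)
  have hl : Filter.Tendsto (fun k => ∑ m ∈ L, E m * ‖P m (y - z k)‖ ^ 2) Filter.atTop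
      (nhds (∑ m ∈ L, E m * ‖P m (y - 0)‖ ^ 2)) := by
    have hc : Continuous fun v => ∑ m ∈ L, E m * ‖P m (y - v)‖ ^ 2 := by fun_prop
    exact (hc.tendsto 0).comp hz0
  have hr : Filter.Tendsto (fun k : ℕ => C * (S + N ^ 2 + w * (N + (1 / ((k : ℝ) + 1)) * t) ^ 2))
      Filter.atTop (nhds (C * (S + N ^ 2 + w * (N + 0 * t) ^ 2))) := by
    have hc : Continuous fun v : ℝ => C * (S + N ^ 2 + w * (N + v * t) ^ 2) := by fun_prop
    exact (hc.tendsto 0).comp hη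
  have := le_of_tendsto_of_tendsto' hl hr hz2
  simpa using this

lemma step_both (hP : ProjFamily P) (hE0 : ∀ n, 0 < E n) {j : ℕ} {C : ℝ} (hC : 0 ≤ C)
    (hrun : RunC P p γ T E j C)
    {W : ℝ → 𝓗 →L[ℂ] 𝓗} (hWc : Continuous W) (hWs : ∀ t, IsSelfAdjoint (W t))
    (hWb : ∀ t m n, wnorm P p γ (W t) m n ≤ 1)
    {ψ : ℝ → 𝓗} (hψD : ∀ t, ψ t ∈ HDom P E)
    (hψ : ∀ t, ∃ d, HasDerivAt ψ d t ∧ ∀ h, IsHSum P E (ψ t) h → Complex.I • d = h + W t (ψ t))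
    {N : ℝ} (hN : ∀ t, ‖ψ t‖ ≤ N) {τ : ℝ} (hτ : 0 < τ) (hτT : τ ≤ T) {n : ℕ} (hn : 1 ≤ n)
    (hper : ∀ k < n, ∀ t, W (t + k * τ) = W t) :
    (∀ S, EB P E (ψ 0) S → EB P E (ψ (n * τ)) (C * (S + N ^ 2 + (n * τ) ^ ((2 : ℝ) / j) * N ^ 2))) ∧
    (∀ S, EB P E (ψ (n * τ)) S → EB P E (ψ 0) (C * (S + N ^ 2 + (n * τ) ^ ((2 : ℝ) / j) * N ^ 2))) := by
  have hψc : Continuous ψ := continuous_iff_continuousAt.2 fun t => by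
    obtain ⟨d, hd, _⟩ := hψ t
    exact hd.continuousAt
  have ht0 : 0 ≤ (n : ℝ) * τ := by positivity
  have main : ∀ L : Finset ℕ+, ∀ η > 0, ∃ F : Finset ℕ+, L ⊆ F ∧
      (∃ z z', PF P F (ψ (n * τ)) = z + z' ∧ ‖z'‖ ≤ C * (η * (n * τ)) ∧ ∑ m ∈ F, E m * ‖P m z‖ ^ 2 ≤
        C * (∑ m ∈ F, E m * ‖P m (PF P F (ψ 0))‖ ^ 2 + N ^ 2 +
          (n * τ) ^ ((2 : ℝ) / j) * (N + η * (n * τ)) ^ 2)) ∧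
      (∃ z z', PF P F (ψ 0) = z + z' ∧ ‖z'‖ ≤ C * (η * (n * τ)) ∧ ∑ m ∈ F, E m * ‖P m z‖ ^ 2 ≤
        C * (∑ m ∈ F, E m * ‖P m (PF P F (ψ (n * τ)))‖ ^ 2 + N ^ 2 +
          (n * τ) ^ ((2 : ℝ) / j) * (N + η * (n * τ)) ^ 2)) := by
    intro L η hη
    obtain ⟨M, hM⟩ := isCompact_Icc.exists_bound_of_continuousOn
      (s := Set.Icc 0 ((n : ℝ) * τ)) hWc.continuousOn
    have hM0 : 0 ≤ M := (norm_nonneg _).trans (hM 0 ⟨le_rfl, ht0⟩)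
    have hKc : IsCompact (ψ '' Set.Icc 0 ((n : ℝ) * τ)) := isCompact_Icc.image hψc
    obtain ⟨F, hF, hLF⟩ := ((PF_unif hP hKc (show 0 < η / (M + 1) by positivity)).and
      (Filter.eventually_ge_atTop L)).exists
    refine ⟨F, hLF, ?_⟩
    let x : Sc P p γ T :=
      { F := F, V := fun t => PF P F * W t * PF P F, τ := τ, hτ := hτ, hτT := hτT
        hV := by fun_prop
        hVsa := fun t => by
          have h1 : star (PF P F) = PF P F := Dg_star hP F _
          rw [star_mul, star_mul, h1, (hWs t).star_eq, mul_assoc]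
        hVb := fun t => trunc_bd hP (hWb t) F }
    refine hrun x n hn (fun k hk t => ?_) (fun t => PF P F (ψ t))
      (fun t => PF P F (W t (ψ t - PF P F (ψ t)))) N η ?_ ?_ ?_ ?_
    · change PF P F * W (t + k * τ) * PF P F = PF P F * W t * PF P F
      rw [hper k hk]
    · intro t
      obtain ⟨d, hd, hd2⟩ := hψ t
      obtain ⟨h, hh⟩ := exists_HSum hP (hψD t)
      have h1 := hd2 h hh
      have hder := ((PF P F).restrictScalars ℝ).hasFDerivAt.comp_hasDerivAt t hd
      have e1 : d = -(Complex.I • (h + W t (ψ t))) := by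
        rw [← h1, smul_smul, Complex.I_mul_I]; simp
      have h3 : PF P F * PF P F = PF P F := PF_mul_Dg hP F _
      have e3 : PF P F (PF P F (ψ t)) = PF P F (ψ t) := by
        change (PF P F * PF P F) (ψ t) = _
        rw [h3]
      have e2 : Dg P F E (PF P F (ψ t)) = Dg P F E (ψ t) := by
        change (Dg P F E * PF P F) (ψ t) = _
        rw [Dg_mul_PF hP]
      have e4 : PF P F d = -(Complex.I • (Dg P F E (PF P F (ψ t)) +
          PF P F (W t (PF P F (PF P F (ψ t)))) + PF P F (W t (ψ t - PF P F (ψ t))))) := by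
        rw [e1, map_neg, map_smul, map_add, PF_HSum hP hh, e2, e3, map_sub, map_sub]
        congr 2; abel
      change HasDerivAt (fun t => PF P F (ψ t)) (-(Complex.I • (Dg P F E (PF P F (ψ t)) +
          PF P F (W t (PF P F (PF P F (ψ t)))) + PF P F (W t (ψ t - PF P F (ψ t)))))) t
      rw [← e4]
      exact hder
    · have : Continuous fun t => W t (ψ t - PF P F (ψ t)) := hWc.clm_apply (by fun_prop)
      fun_prop
    · intro t _
      exact (PF_contr hP F _).trans (hN t)
    · intro t ht
      refine (PF_contr hP F _).trans ?_
      have a1 := (W t).le_of_opNorm_le (hM t ht) (ψ t - PF P F (ψ t))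
      have a2 := hF (ψ t) ⟨t, ht, rfl⟩
      calc _ ≤ M * ‖ψ t - PF P F (ψ t)‖ := a1
        _ ≤ (M + 1) * (η / (M + 1)) := by gcongr; linarith
        _ = η := by field_simp
  have conv : ∀ (L F : Finset ℕ+) (u v z z' : 𝓗) (S w η : ℝ), L ⊆ F → EB P E u S →
      PF P F v = z + z' → ∑ m ∈ F, E m * ‖P m z‖ ^ 2 ≤
        C * (∑ m ∈ F, E m * ‖P m (PF P F u)‖ ^ 2 + N ^ 2 + w * (N + η * (n * τ)) ^ 2) →
      ∑ m ∈ L, E m * ‖P m (v - z')‖ ^ 2 ≤ C * (S + N ^ 2 + w * (N + η * (n * τ)) ^ 2) := by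
    intro L F u v z z' S w η hLF hu hv hz
    have b1 : ∑ m ∈ L, E m * ‖P m (v - z')‖ ^ 2 = ∑ m ∈ L, E m * ‖P m z‖ ^ 2 := by
      refine Finset.sum_congr rfl fun m hm => ?_
      have : P m (v - z') = P m z := by
        rw [map_sub, ← P_PF hP (hLF hm) v, hv, map_add]; abel
      rw [this]
    have b2 : ∑ m ∈ L, E m * ‖P m z‖ ^ 2 ≤ ∑ m ∈ F, E m * ‖P m z‖ ^ 2 :=
      Finset.sum_le_sum_of_subset_of_nonneg hLF fun m _ _ => by have := hE0 m; positivity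
    have b3 : ∑ m ∈ F, E m * ‖P m (PF P F u)‖ ^ 2 ≤ S := by
      refine le_trans (le_of_eq (Finset.sum_congr rfl fun m hm => ?_)) (hu F)
      rw [P_PF hP hm]
    rw [b1]
    refine b2.trans (hz.trans ?_)
    gcongr
  constructor
  · intro S hS L
    refine lim_step (t := n * τ) fun η hη => ?_
    obtain ⟨F, hLF, ⟨z, z', h1, h2, h3⟩, _⟩ := main L η hη
    exact ⟨z', h2, conv L F _ _ z z' S _ η hLF hS h1 h3⟩
  · intro S hS L
    refine lim_step (t := n * τ) fun η hη => ?_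
    obtain ⟨F, hLF, _, ⟨z, z', h1, h2, h3⟩⟩ := main L η hη
    exact ⟨z', h2, conv L F _ _ z z' S _ η hLF hS h1 h3⟩

end

noncomputable section
open ContinuousLinearMap
set_option linter.unusedSectionVars false

variable {𝓗 : Type*} [NormedAddCommGroup 𝓗] [InnerProductSpace ℂ 𝓗] [CompleteSpace 𝓗]
variable {P : ℕ+ → 𝓗 →L[ℂ] 𝓗} {p γ T : ℝ} {E : ℕ+ → ℝ}

lemma EB.mono {x : 𝓗} {S S' : ℝ} (h : EB P E x S) (hS : S ≤ S') : EB P E x S' :=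
  fun F => (h F).trans hS

lemma EB.of_mem (hE0 : ∀ n, 0 < E n) {x : 𝓗} (hx : x ∈ QDom P E) :
    EB P E x (∑' n, E n * ‖P n x‖ ^ 2) := fun F =>
  (show Summable _ from hx).sum_le_tsum F fun n _ => by have := hE0 n; positivity

lemma EB.mem (hE0 : ∀ n, 0 < E n) {x : 𝓗} {S : ℝ} (h : EB P E x S) : x ∈ QDom P E :=
  summable_of_sum_le (fun n => by have := hE0 n; positivity) h

lemma EB.tsum_le {x : 𝓗} {S : ℝ} (h : EB P E x S) : ∑' n, E n * ‖P n x‖ ^ 2 ≤ S :=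
  tsum_le_of_sum_le' h.nonneg h

lemma EB.PF (hP : ProjFamily P) (hE0 : ∀ n, 0 < E n) {x : 𝓗} {S : ℝ} (h : EB P E x S)
    (L : Finset ℕ+) : EB P E (PF P L x) S := fun F => by
  refine le_trans (Finset.sum_le_sum fun m _ => ?_) (h F)
  have := (hE0 m).le
  have := P_PF_le hP L m x
  gcongr

lemma PF_mem_HDom (hP : ProjFamily P) (L : Finset ℕ+) (x : 𝓗) : PF P L x ∈ HDom P E := by
  refine summable_of_ne_finset_zero (s := L) fun m hm => ?_
  have : P m (PF P L x) = 0 := by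
    change (P m * PF P L) x = 0
    rw [PF, P_mul_Dg_nmem hP L hm]; simp
  rw [this]; simp

/-- Passage from vectors in the operator domain to vectors in the form domain. -/
lemma EB_ext (hP : ProjFamily P) (hE0 : ∀ n, 0 < E n) {x : 𝓗} {S B N : ℝ} (A : 𝓗 →L[ℂ] 𝓗)
    (hx : EB P E x S) (hN : ‖x‖ ≤ N)
    (h : ∀ y ∈ HDom P E, ‖y‖ ≤ N → EB P E y S → EB P E (A y) B) : EB P E (A x) B := by
  intro F
  have hc : Continuous fun v => ∑ m ∈ F, E m * ‖P m (A v)‖ ^ 2 := by fun_prop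
  have hl := (hc.tendsto x).comp (PF_tendsto hP x)
  refine le_of_tendsto' hl fun L => ?_
  exact h _ (PF_mem_HDom hP L x) ((PF_contr hP L x).trans hN) (hx.PF hP hE0 L) F

lemma unit_norm {A : 𝓗 →L[ℂ] 𝓗} (h : IsUnitaryOp A) (x : 𝓗) : ‖A x‖ = ‖x‖ := isom_of h.2 x

variable {V : ℝ → 𝓗 →L[ℂ] 𝓗} {U : ℝ → ℝ → 𝓗 →L[ℂ] 𝓗}

lemma prop_step (hP : ProjFamily P) (hE0 : ∀ n, 0 < E n) {j : ℕ} {C : ℝ} (hC : 0 ≤ C)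
    (hrun : RunC P p γ T E j C) (hVc : Continuous V) (hVs : ∀ t, IsSelfAdjoint (V t))
    (hVb : ∀ t m n, wnorm P p γ (V t) m n ≤ 1) (hU : IsPropagator P E V U) (a : ℝ)
    {y : 𝓗} (hy : y ∈ HDom P E) {N : ℝ} (hN : ‖y‖ ≤ N) {τ : ℝ} (hτ : 0 < τ) (hτT : τ ≤ T)
    {n : ℕ} (hn : 1 ≤ n) (hper : ∀ k < n, ∀ t, V (t + k * τ) = V t) :
    (∀ S, EB P E y S → EB P E (U (a + n * τ) a y)
      (C * (S + N ^ 2 + (n * τ) ^ ((2 : ℝ) / j) * N ^ 2))) ∧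
    (∀ S, EB P E (U (a + n * τ) a y) S → EB P E y
      (C * (S + N ^ 2 + (n * τ) ^ ((2 : ℝ) / j) * N ^ 2))) := by
  obtain ⟨hU1, hU2, hU3, hU4, hU5, hU6⟩ := hU
  have h := step_both hP hE0 hC hrun (W := fun t => V (a + t)) (ψ := fun t => U (a + t) a y)
    (hVc.comp (by fun_prop)) (fun t => hVs _) (fun t => hVb _)
    (fun t => by rw [← hU5 (a + t) a]; exact ⟨y, hy, rfl⟩)
    (fun t => by
      obtain ⟨d, hd, hd2⟩ := hU6 a y hy (a + t)
      exact ⟨d, HasDerivAt.comp_const_add a t hd, hd2⟩)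
    (N := N) (fun t => by rw [unit_norm (hU1 _ _)]; exact hN) hτ hτT hn
    (fun k hk t => by rw [← add_assoc]; exact hper k hk _)
  simp only [add_zero, hU3] at h
  exact h

/-- Forward bound including trivial steps. -/
lemma prop_fwd (hP : ProjFamily P) (hE0 : ∀ n, 0 < E n) {j : ℕ} {C : ℝ} (hC : 0 ≤ C)
    (hrun : RunC P p γ T E j C) (hVc : Continuous V) (hVs : ∀ t, IsSelfAdjoint (V t))
    (hVb : ∀ t m n, wnorm P p γ (V t) m n ≤ 1) (hU : IsPropagator P E V U) (a : ℝ)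
    {y : 𝓗} (hy : y ∈ HDom P E) {N : ℝ} (hN : ‖y‖ ≤ N) {τ : ℝ} (hτ : 0 ≤ τ) (hτT : τ ≤ T)
    {n : ℕ} (hper : ∀ k < n, ∀ t, V (t + k * τ) = V t) {t S : ℝ} (ht : n * τ ≤ t)
    (hS : EB P E y S) :
    EB P E (U (a + n * τ) a y) ((C + 1) * (S + N ^ 2 + t ^ ((2 : ℝ) / j) * N ^ 2)) := by
  have hS0 := hS.nonneg
  have h0 : 0 ≤ (n : ℝ) * τ := by positivity
  have hw : ((n : ℝ) * τ) ^ ((2 : ℝ) / j) ≤ t ^ ((2 : ℝ) / j) := by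
    apply Real.rpow_le_rpow h0 ht; positivity
  have hw0 : 0 ≤ t ^ ((2 : ℝ) / j) := Real.rpow_nonneg (h0.trans ht) _
  by_cases hz : (n : ℝ) * τ = 0
  · rw [hz, add_zero, hU.2.2.1]
    refine EB.mono (show EB P E y S from hS) ?_
    have : 0 ≤ N ^ 2 + t ^ ((2 : ℝ) / j) * N ^ 2 := by positivity
    nlinarith [mul_nonneg hC (add_nonneg hS0 this)]
  · have hτ' : 0 < τ := lt_of_le_of_ne hτ fun h => hz (by rw [← h, mul_zero])
    have hn : 1 ≤ n := Nat.one_le_iff_ne_zero.2 fun h => hz (by rw [h]; simp)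
    refine ((prop_step hP hE0 hC hrun hVc hVs hVb hU a hy hN hτ' hτT hn hper).1 S hS).mono ?_
    gcongr
    linarith

lemma prop_pos (hP : ProjFamily P) (hE0 : ∀ n, 0 < E n) {j : ℕ} {C : ℝ} (hC : 0 ≤ C) (hT : 0 < T)
    (hrun : RunC P p γ T E j C) (hVc : Continuous V) (hVs : ∀ t, IsSelfAdjoint (V t))
    (hVT : ∀ t, V (t + T) = V t)
    (hVb : ∀ t m n, wnorm P p γ (V t) m n ≤ 1) (hU : IsPropagator P E V U)
    {x : 𝓗} {t S : ℝ} (ht : 0 ≤ t) (hS : EB P E x S) :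
    EB P E (U t 0 x) ((C + 1) * ((C + 1) * (S + ‖x‖ ^ 2 + t ^ ((2 : ℝ) / j) * ‖x‖ ^ 2)
      + ‖x‖ ^ 2 + t ^ ((2 : ℝ) / j) * ‖x‖ ^ 2)) := by
  refine EB_ext hP hE0 _ hS le_rfl fun y hy hyN hyS => ?_
  have hper : ∀ k : ℕ, ∀ t, V (t + k * T) = V t := by
    intro k
    induction k with
    | zero => intro t; simp
    | succ k ih =>
      intro t
      rw [show t + ((k + 1 : ℕ) : ℝ) * T = (t + k * T) + T by push_cast; ring, hVT, ih]
  set n := ⌊t / T⌋₊ with hn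
  have h1 : (n : ℝ) * T ≤ t := by
    have := Nat.floor_le (show 0 ≤ t / T by positivity)
    rwa [le_div_iff₀ hT] at this
  have h2 : t - n * T ≤ T := by
    have := Nat.lt_floor_add_one (t / T)
    rw [div_lt_iff₀ hT] at this
    rw [← hn] at this
    linarith
  have a1 := prop_fwd hP hE0 hC hrun hVc hVs hVb hU 0 hy hyN hT.le le_rfl (n := n)
    (fun k _ => hper k) h1 hyS
  rw [zero_add] at a1
  have hU5 := hU.2.2.2.2.1
  have hy1 : U (n * T) 0 y ∈ HDom P E := by rw [← hU5 (n * T) 0]; exact ⟨y, hy, rfl⟩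
  have hy1N : ‖U (n * T) 0 y‖ ≤ ‖x‖ := by rw [unit_norm (hU.1 _ _)]; exact hyN
  have a2 := prop_fwd hP hE0 hC hrun hVc hVs hVb hU (n * T) hy1 hy1N (sub_nonneg.2 h1) h2 (n := 1)
    (fun k hk t => by
      have : k = 0 := by omega
      rw [this]; simp) (t := t) (by
      have : 0 ≤ (n : ℝ) * T := by positivity
      rw [Nat.cast_one, one_mul]; linarith) a1
  have e : U (n * T + ((1 : ℕ) : ℝ) * (t - n * T)) (n * T) (U (n * T) 0 y) = U t 0 y := by
    have := hU.2.2.2.1 (n * T + ((1 : ℕ) : ℝ) * (t - n * T)) (n * T) 0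
    rw [show (n : ℝ) * T + ((1 : ℕ) : ℝ) * (t - n * T) = t by rw [Nat.cast_one]; ring] at this ⊢
    rw [← this]; rfl
  rwa [e] at a2

lemma prop_neg (hP : ProjFamily P) (hE0 : ∀ n, 0 < E n) {j : ℕ} {C t : ℝ} (hC : 0 ≤ C) (ht : t < 0)
    (hrun : RunC P p γ (-t) E j C) (hVc : Continuous V) (hVs : ∀ t, IsSelfAdjoint (V t))
    (hVb : ∀ t m n, wnorm P p γ (V t) m n ≤ 1) (hU : IsPropagator P E V U)
    {x : 𝓗} {S : ℝ} (hS : EB P E x S) :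
    EB P E (U t 0 x) (C * (S + ‖x‖ ^ 2 + (((1 : ℕ) : ℝ) * (-t)) ^ ((2 : ℝ) / j) * ‖x‖ ^ 2)) := by
  refine EB_ext hP hE0 _ hS le_rfl fun y hy hyN hyS => ?_
  have hy1 : U t 0 y ∈ HDom P E := by rw [← hU.2.2.2.2.1 t 0]; exact ⟨y, hy, rfl⟩
  have hy1N : ‖U t 0 y‖ ≤ ‖x‖ := by rw [unit_norm (hU.1 _ _)]; exact hyN
  refine (prop_step hP hE0 hC hrun hVc hVs hVb hU t hy1 hy1N (neg_pos.2 ht) le_rfl (n := 1) le_rfl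
    (fun k hk t => by
      have : k = 0 := by omega
      rw [this]; simp)).2 S ?_
  have : U (t + ((1 : ℕ) : ℝ) * -t) t (U t 0 y) = y := by
    rw [show t + ((1 : ℕ) : ℝ) * -t = 0 by rw [Nat.cast_one]; ring]
    have := hU.2.2.2.1 0 t 0
    rw [hU.2.2.1] at this
    exact congrArg (fun B : 𝓗 →L[ℂ] 𝓗 => B y) this
  rwa [this]

end

/-- Theorem 2.3, main theorem: upper bound on the energy growth for
`H(t) = H + V(t)` with shrinking spectral gaps. -/
theorem statement0
    (P : ℕ+ → 𝓗 →L[ℂ] 𝓗) (hP : ProjFamily P)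
    (E : ℕ+ → ℝ) (hE1 : 0 < E 1) (hEmono : StrictMono E)
    (γ cH CH : ℝ) (hγ0 : 0 < γ) (hγh : γ < 1 / 2) (hcH : 0 < cH) (hcC : cH ≤ CH)
    (hgap : ∀ m n : ℕ+,
      cH * |((m : ℕ) : ℝ) - ((n : ℕ) : ℝ)| / (((max m n : ℕ+) : ℕ) : ℝ) ^ (2 * γ)
          ≤ |E m - E n| ∧
      |E m - E n|
          ≤ CH * |((m : ℕ) : ℝ) - ((n : ℕ) : ℝ)| / (((max m n : ℕ+) : ℕ) : ℝ) ^ (2 * γ))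
    (α : ℝ) (hα : α = 1 - 2 * γ)
    (p : ℝ) (hp : 2 < p) (hceil : 1 / (2 * (1 - α)) < ((⌈p - 1⌉ : ℤ) : ℝ))
    (T : ℝ) (hT : 0 < T) :
    ∃ ε > 0, ∀ (V : ℝ → 𝓗 →L[ℂ] 𝓗) (U : ℝ → ℝ → 𝓗 →L[ℂ] 𝓗),
      (∀ t, V (t + T) = V t) →
      (∀ t, IsSelfAdjoint (V t)) →
      StrongC1 V →
      (∀ (t : ℝ) (m n : ℕ+), wnorm P p γ (V t) m n ≤ ε) →
      IsPropagator P E V U →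
      (∀ t : ℝ, ∀ ψ ∈ QDom P E, U t 0 ψ ∈ QDom P E) ∧
      ∀ ψ ∈ QDom P E, ∃ C > 0, ∀ t : ℝ, 0 ≤ t →
        ∑' n : ℕ+, E n * ‖P n (U t 0 ψ)‖ ^ 2 ≤
          C * (1 + t ^ ((2 * α) / (2 * ((⌈p - 1⌉ : ℤ) : ℝ) * (1 - α) - 1))) := by
  have hE0 : ∀ n, 0 < E n := fun n => hE1.trans_le (hEmono.monotone n.one_le)
  have hCH : 0 ≤ CH := hcH.le.trans hcC
  have hα0 : 0 < α := by rw [hα]; linarith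
  have hEH : ∀ m n, |E m - E n| ≤ CH * jp m n * mx m n ^ (-(2 * γ)) := by
    intro m n
    refine (hgap m n).2.trans ?_
    change CH * |((m : ℕ) : ℝ) - ((n : ℕ) : ℝ)| / mx m n ^ (2 * γ) ≤ _
    rw [Real.rpow_neg (mx_pos m n).le, div_eq_mul_inv]
    have h1 : |((m : ℕ) : ℝ) - ((n : ℕ) : ℝ)| ≤ jp m n := le_max_right _ _
    have h2 : 0 < mx m n ^ (2 * γ) := Real.rpow_pos_of_pos (mx_pos m n) _
    gcongr
  have hE : ∀ n : ℕ+, E n ≤ (E 1 + CH) * ((n : ℕ) : ℝ) ^ α := by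
    intro n
    have h1 := (hgap n 1).2
    have hn1 : (1 : ℝ) ≤ ((n : ℕ) : ℝ) := by exact_mod_cast n.one_le
    have hn0 : (0 : ℝ) < ((n : ℕ) : ℝ) := by linarith
    rw [max_eq_left n.one_le] at h1
    have h2 : E n - E 1 ≤ CH * ((n : ℕ) : ℝ) / ((n : ℕ) : ℝ) ^ (2 * γ) := by
      refine (le_abs_self _).trans (h1.trans ?_)
      gcongr
      rw [PNat.one_coe, Nat.cast_one, abs_of_nonneg (by linarith)]
      linarith
    have h3 : CH * ((n : ℕ) : ℝ) / ((n : ℕ) : ℝ) ^ (2 * γ) = CH * ((n : ℕ) : ℝ) ^ α := by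
      rw [hα, Real.rpow_sub hn0, Real.rpow_one, mul_div_assoc]
    have h4 : 1 ≤ ((n : ℕ) : ℝ) ^ α := Real.one_le_rpow hn1 hα0.le
    nlinarith
  obtain ⟨q, hqK⟩ : ∃ q : ℕ, (⌈p - 1⌉ : ℤ) = (q : ℤ) + 1 := by
    have : 0 < ⌈p - 1⌉ := Int.ceil_pos.2 (by linarith)
    exact ⟨(⌈p - 1⌉ - 1).toNat, by omega⟩
  have hqR : ((⌈p - 1⌉ : ℤ) : ℝ) = (q : ℝ) + 1 := by rw [hqK]; push_cast; ring
  have hq : 1 < p - (q : ℝ) := by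
    have := Int.ceil_lt_add_one (p - 1)
    rw [hqR] at this
    linarith
  rw [hqR] at hceil ⊢
  set s := 2 * ((q : ℝ) + 1) * γ with hs
  have h2s : 1 < 2 * s := by
    rw [div_lt_iff₀ (by rw [hα]; linarith)] at hceil
    rw [hα] at hceil
    rw [hs]; linarith
  have hσ : 2 * ((q : ℝ) + 1) * (1 - α) - 1 = 2 * s - 1 := by rw [hs, hα]; ring
  rw [hσ]
  set j := ⌊2 * s / α⌋₊ with hjdef
  have hα1 : α < 1 := by rw [hα]; linarith
  have hj1 : 1 ≤ j := by
    refine Nat.le_floor ?_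
    rw [Nat.cast_one, le_div_iff₀ hα0]; linarith
  have hj : (j : ℝ) * α / 2 ≤ s := by
    have := Nat.floor_le (show 0 ≤ 2 * s / α by positivity)
    rw [le_div_iff₀ hα0] at this
    rw [hjdef]; linarith
  have hjσ : (2 : ℝ) / j ≤ 2 * α / (2 * s - 1) := by
    have h1 := Nat.lt_floor_add_one (2 * s / α)
    rw [← hjdef, div_lt_iff₀ hα0] at h1
    have hj0 : (0 : ℝ) < j := by exact_mod_cast hj1
    rw [div_le_div_iff₀ hj0 (by linarith)]
    nlinarith
  have hrun : ∀ T' : ℝ, ∃ C, 0 ≤ C ∧ RunC P p γ T' E j C := fun T' =>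
    run (T := T') hP hγ0 (by linarith) hq hα (by positivity) hs hE0 hE hCH hEH hj1 hj
  refine ⟨1, one_pos, ?_⟩
  intro V U hVT hVs hV1 hVb hU
  have hVc := cont_of_strongC1 hV1
  obtain ⟨C, hC, hR⟩ := hrun T
  refine ⟨fun t ψ hψ => ?_, fun ψ hψ => ?_⟩
  · have hS := EB.of_mem hE0 hψ
    rcases lt_or_ge t 0 with ht | ht
    · obtain ⟨C', hC', hR'⟩ := hrun (-t)
      exact (prop_neg hP hE0 hC' ht hR' hVc hVs hVb hU hS).mem hE0
    · exact (prop_pos hP hE0 hC hT hR hVc hVs hVT hVb hU ht hS).mem hE0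
  · have hS := EB.of_mem hE0 hψ
    have hS0 := hS.nonneg
    set S := ∑' n, E n * ‖P n ψ‖ ^ 2
    refine ⟨(C + 1) * (C + 2) * (S + 2 * ‖ψ‖ ^ 2) + 1, by positivity, fun t ht => ?_⟩
    refine (prop_pos hP hE0 hC hT hR hVc hVs hVT hVb hU ht hS).tsum_le.trans ?_
    set w := t ^ ((2 : ℝ) / j)
    set v := t ^ (2 * α / (2 * s - 1))
    have hv0 : 0 ≤ v := Real.rpow_nonneg ht _
    have hw0 : 0 ≤ w := Real.rpow_nonneg ht _
    have hwv : w ≤ 1 + v := by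
      rcases le_total t 1 with h | h
      · have : w ≤ 1 := Real.rpow_le_one ht h (by positivity)
        linarith
      · have : w ≤ v := Real.rpow_le_rpow_of_exponent_le h hjσ
        linarith
    set N2 := ‖ψ‖ ^ 2
    have hN2 : 0 ≤ N2 := by positivity
    have b1 : S + N2 + w * N2 ≤ (S + 2 * N2) * (1 + v) := by
      have : w * N2 ≤ (1 + v) * N2 := by gcongr
      nlinarith [mul_nonneg hS0 hv0, mul_nonneg hN2 hv0]
    calc _ ≤ (C + 1) * ((C + 1) * (S + N2 + w * N2) + (S + N2 + w * N2)) := by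
          gcongr ?_ * ?_
          linarith
      _ = (C + 1) * (C + 2) * (S + N2 + w * N2) := by ring
      _ ≤ (C + 1) * (C + 2) * ((S + 2 * N2) * (1 + v)) := by gcongr
      _ ≤ _ := by nlinarith

end
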